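/- Let π₃ = √3·i ∈ ℂ, so that π₃² = −3. In ℂ⟦z⟧ define: E(z) = exp(π₃z) = Σ_{n≥0} (π₃ⁿ/n!)·zⁿ; B(z) = J₀(π₃z) = Σ_{n≥0} (3ⁿ/(4ⁿ·(n!)²))·z^{2n}; 𝔄(z) = Σ_{n≥0} (Σ_{k=0}^{n} C(n,k)²·C(n+k,k)²)·zⁿ; and 𝔥(z) = Σ_{n≥0} (C(2n,n)³/64ⁿ)·zⁿ. Then for all natural numbers r, s, k, the five power series z, E(z), B^{(r)}(z), 𝔄^{(s)}(z), 𝔥^{(k)}(z) are algebraically independent over ℚ, where ^{(r)} denotes the r-fold formal derivative; equivalently, E(z), B^{(r)}(z), 𝔄^{(s)}(z), 𝔥^{(k)}(z) are algebraically independent over ℚ(z). (Final remark of Section 6.) -/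

import Mathlib

theorem algebraicIndependent_pair {R A : Type*} [CommRing R] [CommRing A] [Algebra R A] {x y : A}
    (h : ∀ (N : ℕ) (q : ℕ → ℕ → R),
      ∑ i ∈ Finset.range N, ∑ j ∈ Finset.range N, algebraMap R A (q i j) * (x ^ i * y ^ j) = 0 →
        ∀ i < N, ∀ j < N, q i j = 0) :
    AlgebraicIndependent R ![x, y] := by
  rw [algebraicIndependent_iff]
  intro P hP
  set e : ℕ × ℕ → (Fin 2 →₀ ℕ) := fun t => Finsupp.equivFunOnFinite.symm ![t.1, t.2] with he
  have he_surj : ∀ m : Fin 2 →₀ ℕ, e (m 0, m 1) = m := by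
    intro m; ext i; fin_cases i <;> simp [he]
  have he_inj : Function.Injective e := by
    rintro ⟨a, b⟩ ⟨c, d⟩ hab
    have h0 := DFunLike.congr_fun hab 0
    have h1 := DFunLike.congr_fun hab 1
    simp [he] at h0 h1
    simp [h0, h1]
  set N := P.totalDegree + 1 with hN
  have hlt : ∀ m ∈ P.support, ∀ i, m i < N := by
    intro m hm i
    have h1 := MvPolynomial.le_totalDegree hm
    have h2 : m i ≤ m.sum fun _ e => e := by
      rw [Finsupp.sum_fintype _ _ (by simp)]
      exact Finset.single_le_sum (f := fun i => m i) (by simp) (Finset.mem_univ i)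
    omega
  have key := h N (fun i j => P.coeff (e (i, j))) <| by
    rw [← Finset.sum_product', ← hP, MvPolynomial.aeval_def, MvPolynomial.eval₂_eq']
    symm
    calc _ = ∑ m ∈ (Finset.range N ×ˢ Finset.range N).map ⟨e, he_inj⟩,
          algebraMap R A (P.coeff m) * ∏ i, ![x, y] i ^ m i := by
          apply Finset.sum_subset
          · intro m hm
            rw [Finset.mem_map]
            exact ⟨(m 0, m 1), by simp [hlt m hm], he_surj m⟩
          · intro m _ hm
            simp [MvPolynomial.notMem_support_iff.mp hm]
      _ = _ := by
          rw [Finset.sum_map]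
          refine Finset.sum_congr rfl fun t _ => ?_
          simp [he, Fin.prod_univ_two]
  ext m
  by_cases hm : m ∈ P.support
  · have := key _ (hlt m hm 0) _ (hlt m hm 1)
    simpa [he_surj] using this
  · simpa using MvPolynomial.notMem_support_iff.mp hm

theorem exists_pow_mul_eq_of_frobenius_relation {ι R L : Type*} [CommRing R] [IsDomain R]
    [CommRing L] [IsDomain L] [Algebra R L] (hinj : Function.Injective (algebraMap R L))
    (p : ℕ) [Fact p.Prime] [CharP L p] {m : ι → L} {a : ι → R} (hm : ∀ x, m x ≠ 0)
    (ha : ∀ x, a x ≠ 0) (hma : ∀ x, m x = algebraMap R L (a x) * m x ^ p)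
    (s : Finset ι) (hs : s.Nonempty) (c : ι → R) (hc : ∀ x ∈ s, c x ≠ 0)
    (hsum : ∑ x ∈ s, algebraMap R L (c x) * m x = 0) :
    ∃ x ∈ s, ∃ y ∈ s, x ≠ y ∧ ∃ u v : R, u ≠ 0 ∧ v ≠ 0 ∧
      a y * u ^ (p - 1) = a x * v ^ (p - 1) := by
  classical
  induction s using Finset.strongInduction generalizing c with
  | H s ih =>
    obtain ⟨x₀, hx₀⟩ := hs
    set b : ι → R := fun x => ∏ y ∈ s.erase x, a y with hb
    have hab : ∀ x ∈ s, a x * b x = ∏ y ∈ s, a y := fun x hx => Finset.mul_prod_erase s a hx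
    have hprod : ∏ y ∈ s, a y ≠ 0 := Finset.prod_ne_zero_iff.mpr fun x _ => ha x
    have hp : p.Prime := Fact.out
    have hpow : ∀ z : R, z ^ p = z ^ (p - 1) * z := fun z => by
      rw [← pow_succ, Nat.sub_add_cancel hp.one_le]
    have hsum_p : ∑ x ∈ s, algebraMap R L (c x ^ p * b x) * m x = 0 := by
      have h1 : (∑ x ∈ s, algebraMap R L (c x) * m x) ^ p = 0 := by
        rw [hsum, zero_pow hp.ne_zero]
      rw [sum_pow_char] at h1
      have h2 := congrArg (algebraMap R L (∏ y ∈ s, a y) * ·) h1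
      simp only [mul_zero, Finset.mul_sum] at h2
      rw [← h2]
      refine Finset.sum_congr rfl fun x hx => ?_
      rw [← hab x hx, map_mul, map_mul, map_pow]
      nth_rewrite 1 [hma x]
      ring
    set c' : ι → R := fun x => c x ^ p * b x * c x₀ - c x * (c x₀ ^ p * b x₀) with hc'
    have hsum' : ∑ x ∈ s, algebraMap R L (c' x) * m x = 0 := by
      have : ∀ x ∈ s, algebraMap R L (c' x) * m x =
          algebraMap R L (c x₀) * (algebraMap R L (c x ^ p * b x) * m x) -
          algebraMap R L (c x₀ ^ p * b x₀) * (algebraMap R L (c x) * m x) := by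
        intro x _
        simp only [hc', map_sub, map_mul, map_pow]
        ring
      rw [Finset.sum_congr rfl this, Finset.sum_sub_distrib, ← Finset.mul_sum, ← Finset.mul_sum,
        hsum, hsum_p]
      simp
    by_cases hne : (s.filter fun x => c' x ≠ 0).Nonempty
    · have hss : s.filter (fun x => c' x ≠ 0) ⊂ s := by
        refine Finset.filter_ssubset.mpr ⟨x₀, hx₀, ?_⟩
        simp only [hc', not_not]
        ring
      obtain ⟨x, hx, y, hy, h⟩ := ih _ hss hne c' (fun x hx => (Finset.mem_filter.mp hx).2) (by
        rw [Finset.sum_filter_of_ne]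
        · exact hsum'
        · intro x _ h0 h1
          simp [h1] at h0)
      exact ⟨x, (Finset.mem_filter.mp hx).1, y, (Finset.mem_filter.mp hy).1, h⟩
    · rw [Finset.not_nonempty_iff_eq_empty, Finset.filter_eq_empty_iff] at hne
      obtain ⟨y, hy, hyx⟩ : ∃ y ∈ s, y ≠ x₀ := by
        by_contra! hall
        have : s = {x₀} := by
          ext z
          simp only [Finset.mem_singleton]
          exact ⟨hall z, fun h => h ▸ hx₀⟩
        rw [this, Finset.sum_singleton] at hsum
        rcases mul_eq_zero.mp hsum with h0 | h0
        · exact hc x₀ hx₀ ((map_eq_zero_iff _ hinj).mp h0)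
        · exact hm x₀ h0
      refine ⟨y, hy, x₀, hx₀, hyx, c y, c x₀, hc y hy, hc x₀ hx₀, ?_⟩
      have h0 : c' y = 0 := not_not.mp (hne hy)
      simp only [hc', hpow] at h0
      have h1 : c y ^ (p - 1) * b y = c x₀ ^ (p - 1) * b x₀ := by
        apply mul_left_cancel₀ (mul_ne_zero (hc y hy) (hc x₀ hx₀))
        linear_combination h0
      apply mul_left_cancel₀ hprod
      calc (∏ z ∈ s, a z) * (a x₀ * c y ^ (p - 1)) = a x₀ * a y * (c y ^ (p - 1) * b y) := by
            rw [← hab y hy]; ring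
        _ = (∏ z ∈ s, a z) * (a y * c x₀ ^ (p - 1)) := by
            rw [h1, ← hab x₀ hx₀]; ring

section Multiplicity

open Polynomial

theorem exists_iterate_derivative_pow_mul {F : Type*} [CommRing F] (g U : F[X]) (n : ℕ) :
    (∃ V, derivative (g ^ (n + 3) * U) = g ^ (n + 1) * (g * V)) ∧
    (∃ V, derivative (derivative (g ^ (n + 3) * U)) =
      g ^ (n + 1) * (((n : F[X]) + 3) * (n + 2) * derivative g ^ 2 * U + g * V)) ∧
    (∃ V, derivative (derivative (derivative (g ^ (n + 3) * U))) =
      g ^ n * (((n : F[X]) + 3) * (n + 2) * (n + 1) * derivative g ^ 3 * U + g * V)) := by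
  have h1 : derivative (g ^ (n + 3) * U) =
      g ^ (n + 2) * (((n : F[X]) + 3) * derivative g * U + g * derivative U) := by
    simp only [derivative_mul, derivative_pow, Nat.cast_add, Nat.cast_ofNat,
      map_add, map_natCast, map_ofNat, show n + 3 - 1 = n + 2 by omega]
    ring
  have h2 : derivative (derivative (g ^ (n + 3) * U)) =
      g ^ (n + 1) * (((n : F[X]) + 3) * (n + 2) * derivative g ^ 2 * U +
        g * (((n : F[X]) + 3) * (2 * derivative g * derivative U + derivative (derivative g) * U) +
          g * derivative (derivative U))) := by
    rw [h1]
    simp only [derivative_mul, derivative_pow, Nat.cast_add, Nat.cast_ofNat,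
      derivative_natCast, derivative_ofNat,
      map_add, map_natCast, map_ofNat, show n + 2 - 1 = n + 1 by omega]
    ring
  refine ⟨⟨((n : F[X]) + 3) * derivative g * U + g * derivative U, by rw [h1]; ring⟩, ⟨_, h2⟩, ?_⟩
  set V := ((n : F[X]) + 3) * (2 * derivative g * derivative U + derivative (derivative g) * U) +
          g * derivative (derivative U)
  refine ⟨((n : F[X]) + 3) * (n + 2) * (2 * derivative g * derivative (derivative g) * U +
    derivative g ^ 2 * derivative U) + (n + 2) * derivative g * V + g * derivative V, ?_⟩
  rw [h2]
  simp only [derivative_mul, derivative_pow, Nat.cast_add, Nat.cast_ofNat,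
      derivative_natCast, derivative_ofNat, Nat.cast_one, map_one,
      map_add, map_natCast, map_ofNat, show n + 1 - 1 = n by omega, show 2 - 1 = 1 by omega]
  ring

theorem not_dvd_natCast_of_lt {p : ℕ} [Fact p.Prime] {g : (ZMod p)[X]} (hg : Irreducible g)
    {m : ℕ} (h0 : 0 < m) (hm : m < p) : ¬ g ∣ (m : (ZMod p)[X]) := by
  intro h
  have hm0 : ((m : ZMod p)) ≠ 0 := by
    rw [Ne, ZMod.natCast_eq_zero_iff]
    exact Nat.not_dvd_of_pos_of_lt h0 hm
  refine hg.not_isUnit (isUnit_of_dvd_unit h ?_)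
  rw [← C_eq_natCast, isUnit_C]
  exact hm0.isUnit

theorem not_dvd_derivative_of_irreducible {p : ℕ} [Fact p.Prime] {g : (ZMod p)[X]}
    (hg : Irreducible g) : ¬ g ∣ derivative g := by
  intro h
  have hsep : IsCoprime g (derivative g) := PerfectField.separable_of_irreducible hg
  exact hg.not_isUnit (hsep.isUnit_of_dvd' dvd_rfl h)

/-- A polynomial solution of degree `< p`, not vanishing at `0`, of a third order equation whose
exponents at the only nonzero finite singularities, the roots of `δ`, are `0, 1/2, 1`, is
cube-free. -/
theorem not_cube_dvd_of_differential_equation {p : ℕ} [Fact p.Prime]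
    {Y δ c₁ c₀ : (ZMod p)[X]} (hY0 : Y.coeff 0 ≠ 0) (hdeg : Y.natDegree < p)
    (hδ : Irreducible δ) (hδY : ∀ m, δ ^ m ∣ Y → 2 * m < p)
    (hode : 2 * (X ^ 2 * δ) * derivative (derivative (derivative Y)) +
      (3 * (X ^ 2 * derivative δ) + 6 * (X * δ)) * derivative (derivative Y) +
      c₁ * derivative Y + c₀ * Y = 0)
    {g : (ZMod p)[X]} (hg : Irreducible g) : ¬ g ^ 3 ∣ Y := by
  have hY : Y ≠ 0 := by rintro rfl; simp at hY0
  have factor : ∀ f : (ZMod p)[X], Irreducible f → f ^ 3 ∣ Y →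
      ∃ n U, Y = f ^ (n + 3) * U ∧ ¬ f ∣ U ∧ n + 3 < p := by
    intro f hf h3
    have hfin : FiniteMultiplicity f Y :=
      FiniteMultiplicity.of_prime_left hf.prime hY
    obtain ⟨U, hU, hfU⟩ := hfin.exists_eq_pow_mul_and_not_dvd
    have hle : 3 ≤ multiplicity f Y := hfin.le_multiplicity_of_pow_dvd h3
    obtain ⟨n, hn⟩ := Nat.exists_eq_add_of_le' hle
    rw [hn] at hU
    refine ⟨n, U, hU, hfU, lt_of_le_of_lt ?_ hdeg⟩
    have hU0 : U ≠ 0 := by rintro rfl; simp at hfU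
    rw [hU, natDegree_mul (pow_ne_zero _ hf.ne_zero) hU0, natDegree_pow]
    nlinarith [hf.natDegree_pos]
  have hXg : ∀ f : (ZMod p)[X], Irreducible f → f ∣ Y → ¬ f ∣ X := by
    intro f hf hfY hfX
    have : Associated f X := hf.associated_of_dvd irreducible_X hfX
    have hX : X ∣ Y := this.symm.dvd.trans hfY
    exact hY0 (X_dvd_iff.mp hX)
  have cube : ∀ f : (ZMod p)[X], f ^ 3 ∣ Y → f ∣ Y := fun f h =>
    (dvd_pow_self f (by norm_num)).trans h
  intro h3
  have hpg := hg.prime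
  by_cases hgδ : g ∣ δ
  · have hass : Associated g δ := hg.associated_of_dvd hδ hgδ
    have h3' : δ ^ 3 ∣ Y := (hass.pow_pow (n := 3)).symm.dvd.trans h3
    obtain ⟨n, U, hU, hδU, hn⟩ := factor δ hδ h3'
    obtain ⟨⟨V1, h1⟩, ⟨V2, h2⟩, V3, h3⟩ := exists_iterate_derivative_pow_mul δ U n
    have hm := hδY (n + 3) ⟨U, hU⟩
    rw [hU, h3, h2, h1] at hode
    have hz : δ ^ (n + 1) * (X ^ 2 * derivative δ ^ 3 * U *
        (((n + 3 : ℕ) : (ZMod p)[X]) * ((n + 2 : ℕ) : (ZMod p)[X]) *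
          ((2 * (n + 3) - 1 : ℕ) : (ZMod p)[X])) + δ * (2 * X ^ 2 * V3 +
          3 * X ^ 2 * derivative δ * V2 +
          6 * X * (((n : (ZMod p)[X]) + 3) * ((n : (ZMod p)[X]) + 2) * derivative δ ^ 2 * U +
            δ * V2) +
          c₁ * V1 + c₀ * δ * U)) = 0 := by
      rw [← hode, show 2 * (n + 3) - 1 = 2 * n + 5 by omega]
      push_cast
      ring
    have hz' := (mul_eq_zero.mp hz).resolve_left (pow_ne_zero _ hδ.ne_zero)
    have hd : δ ∣ X ^ 2 * derivative δ ^ 3 * U *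
        (((n + 3 : ℕ) : (ZMod p)[X]) * ((n + 2 : ℕ) : (ZMod p)[X]) *
          ((2 * (n + 3) - 1 : ℕ) : (ZMod p)[X])) :=
      (dvd_add_left (dvd_mul_right _ _)).mp (hz' ▸ dvd_zero δ)
    have hp := hδ.prime
    simp only [hp.dvd_mul] at hd
    rcases hd with ((h | h) | h) | (h | h) | h
    · exact hXg δ hδ (cube δ h3') (hp.dvd_of_dvd_pow h)
    · exact not_dvd_derivative_of_irreducible hδ (hp.dvd_of_dvd_pow h)
    · exact hδU h
    · exact not_dvd_natCast_of_lt hδ (by omega) (by omega) h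
    · exact not_dvd_natCast_of_lt hδ (by omega) (by omega) h
    · exact not_dvd_natCast_of_lt hδ (by omega) (by omega) h
  · obtain ⟨n, U, hU, hgU, hn⟩ := factor g hg h3
    obtain ⟨⟨V1, h1⟩, ⟨V2, h2⟩, V3, h3'⟩ := exists_iterate_derivative_pow_mul g U n
    rw [hU, h3', h2, h1] at hode
    have hz : g ^ n * (X ^ 2 * δ * derivative g ^ 3 * U *
        (((n + 3 : ℕ) : (ZMod p)[X]) * ((n + 2 : ℕ) : (ZMod p)[X]) *
          ((n + 1 : ℕ) : (ZMod p)[X]) * ((2 : ℕ) : (ZMod p)[X])) + g * (2 * X ^ 2 * δ * V3 +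
          (3 * (X ^ 2 * derivative δ) + 6 * (X * δ)) *
          (((n : (ZMod p)[X]) + 3) * ((n : (ZMod p)[X]) + 2) * derivative g ^ 2 * U + g * V2) +
          c₁ * g * V1 + c₀ * g ^ 2 * U)) = 0 := by
      rw [← hode]
      push_cast
      ring
    have hz' := (mul_eq_zero.mp hz).resolve_left (pow_ne_zero _ hg.ne_zero)
    have hd : g ∣ X ^ 2 * δ * derivative g ^ 3 * U *
        (((n + 3 : ℕ) : (ZMod p)[X]) * ((n + 2 : ℕ) : (ZMod p)[X]) *
          ((n + 1 : ℕ) : (ZMod p)[X]) * ((2 : ℕ) : (ZMod p)[X])) :=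
      (dvd_add_left (dvd_mul_right _ _)).mp (hz' ▸ dvd_zero g)
    simp only [hpg.dvd_mul] at hd
    rcases hd with (((h | h) | h) | h) | ((h | h) | h) | h
    · exact hXg g hg (cube g h3) (hpg.dvd_of_dvd_pow h)
    · exact hgδ h
    · exact not_dvd_derivative_of_irreducible hg (hpg.dvd_of_dvd_pow h)
    · exact hgU h
    all_goals exact not_dvd_natCast_of_lt hg (by omega) (by omega) h

/-- Two cube-free polynomials with suitably independent Taylor coefficients at `0` are
multiplicatively independent modulo `(p - 1)`-th powers. -/
theorem exponents_eq_of_mul_pow_eq {p : ℕ} [Fact p.Prime] {Y Z : (ZMod p)[X]}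
    (hY : ∀ g, Irreducible g → ¬ g ^ 3 ∣ Y) (hZ : ∀ g, Irreducible g → ¬ g ^ 3 ∣ Z)
    (hY0 : Y.coeff 0 = 1) (hZ0 : Z.coeff 0 = 1)
    {i j i' j' N : ℕ} (hi : i < N) (hj : j < N) (hi' : i' < N) (hj' : j' < N)
    (hN : 4 * N + 1 < p) {u v : (ZMod p)[X]} (hu : u ≠ 0) (hv : v ≠ 0)
    (h : Y ^ i * Z ^ j * u ^ (p - 1) = Y ^ i' * Z ^ j' * v ^ (p - 1)) :
    Y ^ i * Z ^ j = Y ^ i' * Z ^ j' := by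
  have hYne : Y ≠ 0 := by rintro rfl; simp at hY0
  have hZne : Z ≠ 0 := by rintro rfl; simp at hZ0
  have small : ∀ g : (ZMod p)[X], Irreducible g → ∀ k l, k < N → l < N →
      ¬ g ^ (p - 1) ∣ Y ^ k * Z ^ l := by
    intro g hg k l hk hl hd
    have hYm : emultiplicity g Y < 3 := emultiplicity_lt_iff_not_dvd.mpr (hY g hg)
    have hZm : emultiplicity g Z < 3 := emultiplicity_lt_iff_not_dvd.mpr (hZ g hg)
    have h1 := le_emultiplicity_of_pow_dvd hd
    rw [emultiplicity_mul hg.prime, emultiplicity_pow hg.prime, emultiplicity_pow hg.prime] at h1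
    obtain ⟨y, hy⟩ := ENat.ne_top_iff_exists.mp hYm.ne_top
    obtain ⟨z, hz⟩ := ENat.ne_top_iff_exists.mp hZm.ne_top
    rw [← hy] at h1 hYm
    rw [← hz] at h1 hZm
    norm_cast at h1 hYm hZm
    have : k * y ≤ k * 2 := Nat.mul_le_mul_left _ (by omega)
    have : l * z ≤ l * 2 := Nat.mul_le_mul_left _ (by omega)
    omega
  obtain ⟨G, u', v', hG, hcop, rfl, rfl⟩ : ∃ G u' v' : (ZMod p)[X], G ≠ 0 ∧ IsCoprime u' v' ∧
      u = G * u' ∧ v = G * v' := by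
    obtain ⟨u', hu'⟩ := EuclideanDomain.gcd_dvd_left u v
    obtain ⟨v', hv'⟩ := EuclideanDomain.gcd_dvd_right u v
    have hG : EuclideanDomain.gcd u v ≠ 0 := fun h0 => hu (EuclideanDomain.gcd_eq_zero_iff.mp h0).1
    refine ⟨EuclideanDomain.gcd u v, u', v', hG, ?_, hu', hv'⟩
    obtain ⟨a, b, hab⟩ : ∃ a b, EuclideanDomain.gcd u v = u * a + v * b :=
      ⟨_, _, EuclideanDomain.gcd_eq_gcd_ab u v⟩
    refine ⟨a, b, mul_left_cancel₀ hG ?_⟩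
    calc EuclideanDomain.gcd u v * (a * u' + b * v')
        = (EuclideanDomain.gcd u v * u') * a + (EuclideanDomain.gcd u v * v') * b := by ring
      _ = _ := by rw [← hu', ← hv', ← hab, mul_one]
  have h' : Y ^ i * Z ^ j * u' ^ (p - 1) = Y ^ i' * Z ^ j' * v' ^ (p - 1) := by
    apply mul_left_cancel₀ (pow_ne_zero (p - 1) hG)
    rw [mul_pow, mul_pow] at h
    linear_combination h
  have hunit : ∀ w : (ZMod p)[X], w ≠ 0 → ∀ k l, k < N → l < N → w ^ (p - 1) ∣ Y ^ k * Z ^ l →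
      ∃ c : ZMod p, w = C c := by
    intro w hw k l hk hl hd
    by_contra hcon
    have hnu : ¬ IsUnit w := fun hwu => by
      obtain ⟨c, _, hc⟩ := Polynomial.isUnit_iff.mp hwu
      exact hcon ⟨c, hc.symm⟩
    obtain ⟨g, hg, hgw⟩ := WfDvdMonoid.exists_irreducible_factor hnu hw
    exact small g hg k l hk hl ((pow_dvd_pow_of_dvd hgw _).trans hd)
  obtain ⟨c, rfl⟩ := hunit u' (right_ne_zero_of_mul hu) i' j' hi' hj'
    ((hcop.pow (m := p - 1) (n := p - 1)).dvd_of_dvd_mul_right (h' ▸ dvd_mul_left _ _))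
  obtain ⟨d, rfl⟩ := hunit v' (right_ne_zero_of_mul hv) i j hi hj
    ((hcop.symm.pow (m := p - 1) (n := p - 1)).dvd_of_dvd_mul_right (h' ▸ dvd_mul_left _ _))
  have h0 := congrArg (Polynomial.eval 0) h'
  rw [coeff_zero_eq_eval_zero] at hY0 hZ0
  simp only [eval_mul, eval_pow, hY0, hZ0, eval_C, one_pow, one_mul] at h0
  apply mul_right_cancel₀ (pow_ne_zero (p - 1) (right_ne_zero_of_mul hu))
  rw [h']
  rw [← C_pow, ← C_pow, h0]

/-- The exponents of a monomial in two normalised polynomials can be read off from its first two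
Taylor coefficients. -/
theorem logarithmic_coeffs_eq {F : Type*} [CommRing F] {Y Z : F[X]}
    (hY0 : Y.coeff 0 = 1) (hZ0 : Z.coeff 0 = 1) {i j i' j' : ℕ}
    (h : Y ^ i * Z ^ j = Y ^ i' * Z ^ j') :
    (i : F) * Y.coeff 1 + j * Z.coeff 1 = i' * Y.coeff 1 + j' * Z.coeff 1 ∧
    (i : F) * (2 * Y.coeff 2 - Y.coeff 1 ^ 2) + j * (2 * Z.coeff 2 - Z.coeff 1 ^ 2) =
      i' * (2 * Y.coeff 2 - Y.coeff 1 ^ 2) + j' * (2 * Z.coeff 2 - Z.coeff 1 ^ 2) := by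
  have key : ∀ (i j : ℕ), (Y ^ i * Z ^ j).coeff 1 = i * Y.coeff 1 + j * Z.coeff 1 ∧
      2 * (Y ^ i * Z ^ j).coeff 2 - (Y ^ i * Z ^ j).coeff 1 ^ 2 =
        i * (2 * Y.coeff 2 - Y.coeff 1 ^ 2) + j * (2 * Z.coeff 2 - Z.coeff 1 ^ 2) ∧
      (Y ^ i * Z ^ j).coeff 0 = 1 := by
    have mul : ∀ A B : F[X], A.coeff 0 = 1 → B.coeff 0 = 1 →
        (A * B).coeff 0 = 1 ∧ (A * B).coeff 1 = A.coeff 1 + B.coeff 1 ∧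
        2 * (A * B).coeff 2 - (A * B).coeff 1 ^ 2 =
          (2 * A.coeff 2 - A.coeff 1 ^ 2) + (2 * B.coeff 2 - B.coeff 1 ^ 2) := by
      intro A B hA hB
      simp only [coeff_mul, Finset.Nat.antidiagonal_succ, Finset.Nat.antidiagonal_zero,
        Finset.sum_cons, Finset.map_cons, Finset.map_singleton, Finset.sum_singleton,
        Function.Embedding.prodMap, Function.Embedding.coeFn_mk, Prod.map,
        Function.Embedding.refl_apply, Nat.succ_eq_add_one, hA, hB]
      refine ⟨by ring, by ring, by ring⟩
    intro i j
    induction i with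
    | zero =>
      induction j with
      | zero => simp [coeff_one]
      | succ j ih =>
        obtain ⟨h1, h2, h3⟩ := ih
        obtain ⟨m0, m1, m2⟩ := mul _ _ h3 hZ0
        rw [pow_succ, ← mul_assoc]
        refine ⟨by rw [m1, h1]; push_cast; ring, by rw [m2, h2]; push_cast; ring, m0⟩
    | succ i ih =>
      obtain ⟨h1, h2, h3⟩ := ih
      obtain ⟨m0, m1, m2⟩ := mul _ _ hY0 h3
      rw [pow_succ', mul_assoc]
      refine ⟨by rw [m1, h1]; push_cast; ring, by rw [m2, h2]; push_cast; ring, m0⟩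
  obtain ⟨h1, h2, _⟩ := key i j
  obtain ⟨h1', h2', _⟩ := key i' j'
  rw [h] at h1 h2
  exact ⟨h1.symm.trans h1', h2.symm.trans h2'⟩

end Multiplicity

section Recurrences

open Polynomial

/-- The Apéry numbers `1, 5, 73, 1445, …`. -/
def aperyNumber (n : ℕ) : ℕ :=
  ∑ j ∈ Finset.range (n + 1), n.choose j ^ 2 * (n + j).choose j ^ 2

theorem exists_choose_mul_choose_eq (n k : ℕ) : ∃ x : ℚ,
    (n + 2).choose (k + 1) * (n + 2 + (k + 1)).choose (k + 1) = (n + k + 3) * (n + k + 2) * x ∧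
    (n + 1).choose (k + 1) * (n + 1 + (k + 1)).choose (k + 1) = (n + k + 2) * (n + 1 - k) * x ∧
    n.choose (k + 1) * (n + (k + 1)).choose (k + 1) = (n + 1 - k) * (n - k) * x ∧
    (n + 1).choose k * (n + 1 + k).choose k = (k + 1 : ℚ) ^ 2 * x := by
  have right : ∀ a b : ℕ, (a.choose (b + 1) : ℚ) * (b + 1) = a.choose b * (a - b) := by
    intro a b
    rcases le_or_gt b a with h | h
    · have := Nat.choose_succ_right_eq a b
      rw [← Nat.cast_sub h]
      exact_mod_cast this
    · simp [Nat.choose_eq_zero_of_lt h, Nat.choose_eq_zero_of_lt (show a < b + 1 by omega)]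
  have diag : ∀ a b : ℕ, ((a + 1).choose (b + 1) : ℚ) * (b + 1) = (a + 1) * a.choose b := by
    intro a b
    exact_mod_cast (Nat.add_one_mul_choose_eq a b).symm
  have up : ∀ a b : ℕ, ((a + 1).choose b : ℚ) * (a + 1 - b) = (a + 1) * a.choose b := by
    intro a b
    have h1 := right (a + 1) b
    have h2 := diag a b
    push_cast at h1
    linarith
  have hk : (k : ℚ) + 1 ≠ 0 := by positivity
  have hn : (n : ℚ) + 1 ≠ 0 := by positivity
  have hn2 : (n : ℚ) + 2 ≠ 0 := by positivity
  refine ⟨(n + 1).choose k * (n + 1 + k).choose k / (k + 1 : ℚ) ^ 2, ?_, ?_, ?_, ?_⟩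
  · have e1 := diag (n + 1) k
    have e2 := diag (n + 1 + 1 + k) k
    have e3 := up (n + 1 + k) k
    rw [show n + 1 + k + 1 = n + 1 + 1 + k by ring] at e3
    rw [show n + 2 + (k + 1) = n + 1 + 1 + k + 1 by ring, show n + 2 = n + 1 + 1 by ring]
    push_cast at e1 e2 e3
    generalize ((n + 1 + 1).choose (k + 1) : ℚ) = A at *
    generalize ((n + 1 + 1 + k + 1).choose (k + 1) : ℚ) = B at *
    generalize ((n + 1 + 1 + k).choose k : ℚ) = C at *
    generalize ((n + 1).choose k : ℚ) = D at *
    generalize ((n + 1 + k).choose k : ℚ) = G at *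
    field_simp
    apply mul_right_cancel₀ hn2
    have : C * (n + 2) = (n + k + 2) * G := by linear_combination e3
    linear_combination B * (k + 1) * (n + 2) * e1 + (n + 2) * D * (n + 2) * e2 +
      (n + 2) * D * (n + 3 + k) * this
  · have e1 := right (n + 1) k
    have e2 := diag (n + 1 + k) k
    rw [show n + 1 + (k + 1) = n + 1 + k + 1 by ring]
    push_cast at e1 e2
    generalize ((n + 1).choose (k + 1) : ℚ) = A at *
    generalize ((n + 1 + k + 1).choose (k + 1) : ℚ) = B at *
    generalize ((n + 1).choose k : ℚ) = D at *
    generalize ((n + 1 + k).choose k : ℚ) = G at *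
    field_simp
    linear_combination B * (k + 1) * e1 + D * (n + 1 - k) * e2
  · have e1 := right n k
    have e2 := up n k
    have e3 := right (n + 1 + k) k
    rw [show n + (k + 1) = n + 1 + k by ring]
    push_cast at e1 e2 e3
    generalize (n.choose (k + 1) : ℚ) = A at *
    generalize ((n + 1 + k).choose (k + 1) : ℚ) = B at *
    generalize (n.choose k : ℚ) = C at *
    generalize ((n + 1).choose k : ℚ) = D at *
    generalize ((n + 1 + k).choose k : ℚ) = G at *
    field_simp
    linear_combination B * (k + 1) * e1 + C * (n - k) * e3 - (n - k) * G * e2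
  · field_simp

/-- Apéry's three-term recurrence. -/
theorem aperyNumber_recurrence (n : ℕ) :
    ((n : ℚ) + 2) ^ 3 * aperyNumber (n + 2) -
      (34 * ((n : ℚ) + 1) ^ 3 + 51 * ((n : ℚ) + 1) ^ 2 + 27 * ((n : ℚ) + 1) + 5) *
        aperyNumber (n + 1) + ((n : ℚ) + 1) ^ 3 * aperyNumber n = 0 := by
  have ext : ∀ m d : ℕ, (aperyNumber m : ℚ) =
      ∑ j ∈ Finset.range (m + 1 + d), ((m.choose j : ℚ) * (m + j).choose j) ^ 2 := by
    intro m d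
    rw [aperyNumber, Finset.sum_range_add _ (m + 1) d, Finset.sum_eq_zero (s := Finset.range d)]
    · push_cast
      simp [mul_pow]
    · intro x _
      rw [Nat.choose_eq_zero_of_lt (by omega)]
      simp
  have tele : ∀ K : ℕ, ∑ j ∈ Finset.range (K + 1),
      (((n : ℚ) + 2) ^ 3 * (((n + 2).choose j : ℚ) * (n + 2 + j).choose j) ^ 2 -
      (34 * ((n : ℚ) + 1) ^ 3 + 51 * ((n : ℚ) + 1) ^ 2 + 27 * ((n : ℚ) + 1) + 5) *
        (((n + 1).choose j : ℚ) * (n + 1 + j).choose j) ^ 2 +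
      ((n : ℚ) + 1) ^ 3 * ((n.choose j : ℚ) * (n + j).choose j) ^ 2) =
      4 * (2 * n + 3) * (K * (2 * K + 1) - (2 * n + 3) ^ 2) *
        (((n + 1).choose K : ℚ) * (n + 1 + K).choose K) ^ 2 := by
    intro K
    induction K with
    | zero => simp; ring
    | succ K ih =>
      obtain ⟨x, h1, h2, h3, h4⟩ := exists_choose_mul_choose_eq n K
      rw [Finset.sum_range_succ, ih, h1, h2, h3, h4]
      push_cast
      ring
  have := tele (n + 2)
  rw [Nat.choose_eq_zero_of_lt (show n + 1 < n + 2 by omega)] at this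
  rw [ext (n + 2) 0, ext (n + 1) 1, ext n 2, Finset.mul_sum, Finset.mul_sum, Finset.mul_sum]
  rw [Finset.sum_add_distrib, Finset.sum_sub_distrib] at this
  simpa using this

theorem coeff_third_order_operator {F : Type*} [CommRing F] (Y : F[X]) (α β a b c d : F) :
    let L := 2 * (X ^ 2 * (1 + C α * X + C β * X ^ 2)) *
        derivative (derivative (derivative Y)) +
      (3 * (X ^ 2 * derivative (1 + C α * X + C β * X ^ 2)) +
        6 * (X * (1 + C α * X + C β * X ^ 2))) * derivative (derivative Y) +
      (2 + C a * X + C b * X ^ 2) * derivative Y + (C c + C d * X) * Y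
    L.coeff 0 = 2 * Y.coeff 1 + c * Y.coeff 0 ∧
    ∀ n : ℕ, L.coeff (n + 1) = 2 * (n + 2) ^ 3 * Y.coeff (n + 2) +
      (2 * α * ((n + 1) * n * (n - 1)) + 9 * α * ((n + 1) * n) + a * (n + 1) + c) *
        Y.coeff (n + 1) +
      (2 * β * (n * (n - 1) * (n - 2)) + 12 * β * (n * (n - 1)) + b * n + d) * Y.coeff n := by
  intro L
  have hL : L = C 2 * (X ^ 2 * derivative (derivative (derivative Y))) +
      C (2 * α) * (X ^ 3 * derivative (derivative (derivative Y))) +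
      C (2 * β) * (X ^ 4 * derivative (derivative (derivative Y))) +
      C 6 * (X ^ 1 * derivative (derivative Y)) +
      C (9 * α) * (X ^ 2 * derivative (derivative Y)) +
      C (12 * β) * (X ^ 3 * derivative (derivative Y)) +
      C 2 * derivative Y + C a * (X ^ 1 * derivative Y) + C b * (X ^ 2 * derivative Y) +
      C c * Y + C d * (X ^ 1 * Y) := by
    simp only [L, derivative_add, derivative_one, derivative_C_mul, derivative_X, derivative_X_pow,
      map_mul, map_ofNat, Nat.cast_ofNat]
    ring
  rw [hL]
  constructor
  · simp [coeff_derivative]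
  · intro n
    simp only [coeff_add, coeff_C_mul, coeff_X_pow_mul', coeff_derivative]
    rcases n with _ | _ | _ | n
    · simp
      ring
    · norm_num
      ring
    · norm_num
      ring
    · simp only [show n + 1 + 1 + 1 + 1 - 2 = n + 2 by omega,
        show n + 1 + 1 + 1 + 1 - 3 = n + 1 by omega,
        show n + 1 + 1 + 1 + 1 - 4 = n by omega, show n + 1 + 1 + 1 + 1 - 1 = n + 3 by omega,
        show 2 ≤ n + 1 + 1 + 1 + 1 by omega, show 3 ≤ n + 1 + 1 + 1 + 1 by omega,
        show 4 ≤ n + 1 + 1 + 1 + 1 by omega, show 1 ≤ n + 1 + 1 + 1 + 1 by omega, if_true]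
      push_cast
      ring

/-- A truncated mod `p` solution of the recurrence still satisfies the differential equation. -/
theorem third_order_operator_trunc_eq_zero {p : ℕ} [Fact p.Prime] (u : ℕ → ZMod p)
    {α β a b c d : ZMod p} (h0 : 2 * u 1 + c * u 0 = 0) (hb : 12 * β - b + d = 0)
    (hu : ∀ n : ℕ, 2 * (n + 2) ^ 3 * u (n + 2) +
      (2 * α * ((n + 1) * n * (n - 1)) + 9 * α * ((n + 1) * n) + a * (n + 1) + c) * u (n + 1) +
      (2 * β * (n * (n - 1) * (n - 2)) + 12 * β * (n * (n - 1)) + b * n + d) * u n = 0) :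
    2 * (X ^ 2 * (1 + C α * X + C β * X ^ 2)) *
        derivative (derivative (derivative (PowerSeries.trunc p (.mk u)))) +
      (3 * (X ^ 2 * derivative (1 + C α * X + C β * X ^ 2)) +
        6 * (X * (1 + C α * X + C β * X ^ 2))) *
          derivative (derivative (PowerSeries.trunc p (.mk u))) +
      (2 + C a * X + C b * X ^ 2) * derivative (PowerSeries.trunc p (.mk u)) +
      (C c + C d * X) * PowerSeries.trunc p (.mk u) = 0 := by
  have hp := (Fact.out : p.Prime).two_le
  have hp0 : (p : ZMod p) = 0 := CharP.cast_eq_zero _ p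
  obtain ⟨e0, e1⟩ := coeff_third_order_operator (PowerSeries.trunc p (.mk u)) α β a b c d
  ext n
  rcases n with _ | n
  · rw [e0]
    simpa [PowerSeries.coeff_trunc, show 0 < p by omega, show 1 < p by omega] using h0
  · rw [e1]
    simp only [PowerSeries.coeff_trunc, PowerSeries.coeff_mk, coeff_zero]
    have h := hu n
    rcases lt_trichotomy (n + 2) p with h2 | h2 | h2
    · simpa [h2, show n + 1 < p by omega, show n < p by omega] using h
    · have : (n : ZMod p) + 2 = 0 := by
        exact_mod_cast (congrArg (Nat.cast : ℕ → ZMod p) h2).trans hp0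
      rw [this] at h ⊢
      simpa [show n + 1 < p by omega, show n < p by omega] using h
    · rcases (show p ≤ n + 1 by omega).eq_or_lt with h3 | h3
      · have : (n : ZMod p) = -1 := by
          rw [eq_neg_iff_add_eq_zero]
          exact_mod_cast (congrArg (Nat.cast : ℕ → ZMod p) h3.symm).trans hp0
        rw [if_neg (by omega), if_neg (by omega), this]
        linear_combination (if n < p then u n else 0) * hb
      · simp [show ¬ n + 2 < p by omega, show ¬ n + 1 < p by omega, show ¬ n < p by omega]

theorem natDegree_trunc_mk_lt {p : ℕ} [Fact p.Prime] (u : ℕ → ZMod p) :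
    (PowerSeries.trunc p (.mk u)).natDegree < p := by
  have := PowerSeries.natDegree_trunc_lt (PowerSeries.mk u) (p - 1)
  have hp := (Fact.out : p.Prime).pos
  rwa [show p - 1 + 1 = p by omega] at this

theorem cast_aperyNumber_recurrence {R : Type*} [CommRing R] (n : ℕ) :
    ((n : R) + 2) ^ 3 * aperyNumber (n + 2) -
      (34 * ((n : R) + 1) ^ 3 + 51 * ((n : R) + 1) ^ 2 + 27 * ((n : R) + 1) + 5) *
        aperyNumber (n + 1) + ((n : R) + 1) ^ 3 * aperyNumber n = 0 := by
  have h : ((n : ℤ) + 2) ^ 3 * aperyNumber (n + 2) -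
      (34 * ((n : ℤ) + 1) ^ 3 + 51 * ((n : ℤ) + 1) ^ 2 + 27 * ((n : ℤ) + 1) + 5) *
        aperyNumber (n + 1) + ((n : ℤ) + 1) ^ 3 * aperyNumber n = 0 := by
    exact_mod_cast aperyNumber_recurrence n
  have := congrArg (Int.cast : ℤ → R) h
  push_cast at this
  exact this

theorem not_cube_dvd_trunc_aperyNumber {p : ℕ} [Fact p.Prime] (hp : p % 8 = 5)
    {g : (ZMod p)[X]} (hg : Irreducible g) :
    ¬ g ^ 3 ∣ PowerSeries.trunc p (.mk fun n => (aperyNumber n : ZMod p)) := by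
  have hp5 : 5 ≤ p := by omega
  have hdeg := natDegree_trunc_mk_lt fun n => (aperyNumber n : ZMod p)
  have hY0 : (PowerSeries.trunc p (.mk fun n => (aperyNumber n : ZMod p))).coeff 0 ≠ 0 := by
    simp [PowerSeries.coeff_trunc, show 0 < p by omega, aperyNumber]
  have htwo : (2 : ZMod p) ≠ 0 := by
    have : ((2 : ℕ) : ZMod p) ≠ 0 := by
      rw [Ne, ZMod.natCast_eq_zero_iff]
      exact Nat.not_dvd_of_pos_of_lt (by omega) (by omega)
    simpa using this
  have hthree : (3 : ZMod p) ≠ 0 := by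
    have : ((3 : ℕ) : ZMod p) ≠ 0 := by
      rw [Ne, ZMod.natCast_eq_zero_iff]
      exact Nat.not_dvd_of_pos_of_lt (by omega) (by omega)
    simpa using this
  have hd : (1 + C (-34) * X + C 1 * X ^ 2 : (ZMod p)[X]).natDegree = 2 := by
    compute_degree!
  have hδ : Irreducible (1 + C (-34) * X + C 1 * X ^ 2 : (ZMod p)[X]) := by
    refine irreducible_of_degree_le_three_of_not_isRoot (by rw [hd]; simp) fun r hr => ?_
    have hs : ¬ IsSquare (2 : ZMod p) := by
      rw [ZMod.exists_sq_eq_two_iff (by omega)]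
      omega
    apply hs
    have hr' : 1 + -34 * r + 1 * r ^ 2 = 0 := by
      simpa only [IsRoot.def, eval_add, eval_mul, eval_one, eval_C, eval_X, eval_pow] using hr
    refine ⟨(r - 17) / (2 * 2 * 3), ?_⟩
    field_simp
    linear_combination -hr'
  refine not_cube_dvd_of_differential_equation hY0 hdeg hδ (fun m hm => ?_)
    (third_order_operator_trunc_eq_zero (fun n => (aperyNumber n : ZMod p))
      (α := -34) (β := 1) (a := -224) (b := 14) (c := -10) (d := 2) ?_ ?_ ?_) hg
  · have := natDegree_le_of_dvd hm (by intro h; simp [h] at hY0)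
    rw [natDegree_pow, hd] at this
    omega
  · simp [aperyNumber, Finset.sum_range_succ]
    norm_num
  · norm_num
  · intro n
    have := cast_aperyNumber_recurrence (R := ZMod p) n
    linear_combination 2 * this

theorem succ_mul_eight_mul_choose_cube {p : ℕ} [Fact p.Prime] (hp : p ≠ 2) (n : ℕ) :
    8 * ((n : ZMod p) + 1) ^ 3 * (((2 * (n + 1)).choose (n + 1) : ZMod p) ^ 3 / 64 ^ (n + 1)) =
      (2 * n + 1) ^ 3 * (((2 * n).choose n : ZMod p) ^ 3 / 64 ^ n) := by
  have h := congrArg (Nat.cast : ℕ → ZMod p) (Nat.succ_mul_centralBinom_succ n)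
  simp only [Nat.centralBinom] at h
  push_cast at h
  have h64 : (64 : ZMod p) ≠ 0 := by
    have h2 : ((2 : ℕ) : ZMod p) ≠ 0 := by
      rw [Ne, ZMod.natCast_eq_zero_iff, Nat.prime_dvd_prime_iff_eq Fact.out Nat.prime_two]
      exact hp
    have := pow_ne_zero 6 h2
    norm_num at this
    exact this
  generalize ((2 * (n + 1)).choose (n + 1) : ZMod p) = A at *
  generalize ((2 * n).choose n : ZMod p) = B at *
  rw [pow_succ]
  field_simp
  have h3 := congrArg (· ^ 3) h
  simp only [mul_pow] at h3
  linear_combination 8 * 64 ^ n * h3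

theorem centralBinom_cast_eq_zero {p : ℕ} [Fact p.Prime] {n : ℕ} (h1 : p < 2 * n + 1)
    (h2 : n < p) : ((2 * n).choose n : ZMod p) = 0 := by
  rw [ZMod.natCast_eq_zero_iff]
  have hp : p.Prime := Fact.out
  rcases (show p ≤ 2 * n by omega).eq_or_lt with h | h
  · exact hp.dvd_choose (by omega) (by omega) (by omega)
  · exact hp.dvd_choose (by omega) (by omega) (by omega)

theorem not_cube_dvd_trunc_choose_cube {p : ℕ} [Fact p.Prime] (hp : p ≠ 2)
    {g : (ZMod p)[X]} (hg : Irreducible g) :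
    ¬ g ^ 3 ∣ PowerSeries.trunc p (.mk fun n => ((2 * n).choose n : ZMod p) ^ 3 / 64 ^ n) := by
  have hp2 := (Fact.out : p.Prime).two_le
  have hdeg := natDegree_trunc_mk_lt fun n => ((2 * n).choose n : ZMod p) ^ 3 / 64 ^ n
  have hY0 : (PowerSeries.trunc p
      (.mk fun n => ((2 * n).choose n : ZMod p) ^ 3 / 64 ^ n)).coeff 0 ≠ 0 := by
    simp [PowerSeries.coeff_trunc, show 0 < p by omega]
  have htwo : (2 : ZMod p) ≠ 0 := by
    have h2 : ((2 : ℕ) : ZMod p) ≠ 0 := by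
      rw [Ne, ZMod.natCast_eq_zero_iff, Nat.prime_dvd_prime_iff_eq Fact.out Nat.prime_two]
      exact hp
    simpa using h2
  have hd : (1 + C (-1) * X + C 0 * X ^ 2 : (ZMod p)[X]).natDegree = 1 := by
    rw [C_0, zero_mul, add_zero]
    compute_degree!
  have hδ : Irreducible (1 + C (-1) * X + C 0 * X ^ 2 : (ZMod p)[X]) :=
    irreducible_of_degree_eq_one ((degree_eq_iff_natDegree_eq_of_pos one_pos).mpr hd)
  have hrec := succ_mul_eight_mul_choose_cube hp
  have h4 : (4 : ZMod p) ≠ 0 := by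
    have := pow_ne_zero 2 htwo
    norm_num at this
    exact this
  refine not_cube_dvd_of_differential_equation hY0 hdeg hδ (fun m hm => ?_)
    (third_order_operator_trunc_eq_zero _
      (α := -1) (β := 0) (a := -13 / 2) (b := 0) (c := -1 / 4) (d := 0) ?_ ?_ ?_) hg
  · have h1 := natDegree_le_of_dvd hm (by intro h; simp [h] at hY0)
    rw [natDegree_pow, hd] at h1
    have h2 : (PowerSeries.trunc p
        (.mk fun n => ((2 * n).choose n : ZMod p) ^ 3 / 64 ^ n)).natDegree ≤ (p - 1) / 2 := by
      rw [natDegree_le_iff_coeff_eq_zero]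
      intro n hn
      rw [PowerSeries.coeff_trunc, PowerSeries.coeff_mk]
      split_ifs with h
      · rw [centralBinom_cast_eq_zero (by omega) h]
        simp
      · rfl
    omega
  · have := hrec 0
    field_simp
    simp at this ⊢
    linear_combination this
  · simp
  · intro n
    have := hrec (n + 1)
    push_cast at this
    rw [show n + 2 = n + 1 + 1 by rfl]
    generalize ((2 * (n + 1 + 1)).choose (n + 1 + 1) : ZMod p) ^ 3 / 64 ^ (n + 1 + 1) = A at *
    generalize ((2 * (n + 1)).choose (n + 1) : ZMod p) ^ 3 / 64 ^ (n + 1) = B at *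
    field_simp
    linear_combination 2 * this

end Recurrences

section Lucas

theorem choose_add_cast_eq_mul {p : ℕ} [Fact p.Prime] {a c : ℕ} (ha : a < p) (hc : c < p)
    (b d : ℕ) : ((a + p * b + (c + p * d)).choose (c + p * d) : ZMod p) =
      (a + c).choose c * (b + d).choose d := by
  have hp := (Fact.out : p.Prime).pos
  have lucas : ∀ x y z w : ℕ, x < p → z < p →
      ((x + p * y).choose (z + p * w) : ZMod p) = x.choose z * y.choose w := by
    intro x y z w hx hz
    have := Choose.choose_modEq_choose_mod_mul_choose_div_nat (p := p) (n := x + p * y)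
      (k := z + p * w)
    rw [Nat.add_mul_mod_self_left, Nat.add_mul_mod_self_left, Nat.mod_eq_of_lt hx,
      Nat.mod_eq_of_lt hz, Nat.add_mul_div_left _ _ hp, Nat.add_mul_div_left _ _ hp,
      Nat.div_eq_of_lt hx, Nat.div_eq_of_lt hz, zero_add, zero_add] at this
    exact_mod_cast (ZMod.natCast_eq_natCast_iff _ _ _).mpr this
  rcases lt_or_ge (a + c) p with h | h
  · rw [← lucas _ _ _ _ h hc]
    congr 2
    ring
  · have h1 := lucas (a + c - p) (b + d + 1) c d (by omega) hc
    have h2 := lucas (a + c - p) 1 c 0 (by omega) hc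
    rw [Nat.choose_eq_zero_of_lt (show a + c - p < c by omega)] at h1 h2
    have e1 : a + p * b + (c + p * d) = a + c - p + p * (b + d + 1) := by
      have : p * (b + d + 1) = p * b + p * d + p := by ring
      omega
    have e2 : a + c = a + c - p + p * 1 := by omega
    rw [e1, h1, e2]
    simp only [mul_zero, add_zero] at h2
    rw [mul_one] at h2 ⊢
    rw [h2]
    simp

theorem choose_cast_eq_mul {p : ℕ} [Fact p.Prime] {a c : ℕ} (ha : a < p) (hc : c < p)
    (b d : ℕ) : ((a + p * b).choose (c + p * d) : ZMod p) = a.choose c * b.choose d := by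
  have hp := (Fact.out : p.Prime).pos
  have := Choose.choose_modEq_choose_mod_mul_choose_div_nat (p := p) (n := a + p * b)
    (k := c + p * d)
  rw [Nat.add_mul_mod_self_left, Nat.add_mul_mod_self_left, Nat.mod_eq_of_lt ha,
    Nat.mod_eq_of_lt hc, Nat.add_mul_div_left _ _ hp, Nat.add_mul_div_left _ _ hp,
    Nat.div_eq_of_lt ha, Nat.div_eq_of_lt hc, zero_add, zero_add] at this
  exact_mod_cast (ZMod.natCast_eq_natCast_iff _ _ _).mpr this

theorem sum_range_mul_eq_sum_sum {M : Type*} [AddCommMonoid M] (f : ℕ → M) (p n : ℕ) :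
    ∑ j ∈ Finset.range (p * n), f j =
      ∑ c ∈ Finset.range p, ∑ d ∈ Finset.range n, f (c + p * d) := by
  induction n with
  | zero => simp
  | succ n ih =>
    rw [Nat.mul_succ, Finset.sum_range_add, ih, ← Finset.sum_add_distrib]
    refine Finset.sum_congr rfl fun c _ => ?_
    rw [Finset.sum_range_succ, add_comm c]

theorem aperyNumber_eq_sum_range (R : Type*) [CommRing R] {n M : ℕ} (h : n < M) :
    (aperyNumber n : R) = ∑ j ∈ Finset.range M, (n.choose j : R) ^ 2 * (n + j).choose j ^ 2 := by
  obtain ⟨d, rfl⟩ := Nat.exists_eq_add_of_lt h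
  rw [aperyNumber, show n + d + 1 = n + 1 + d by ring, Finset.sum_range_add _ (n + 1) d,
    Finset.sum_eq_zero (s := Finset.range d)]
  · push_cast
    simp
  · intro x _
    rw [Nat.choose_eq_zero_of_lt (by omega)]
    simp

theorem aperyNumber_lucas {p : ℕ} [Fact p.Prime] {a : ℕ} (ha : a < p) (b : ℕ) :
    (aperyNumber (a + p * b) : ZMod p) = aperyNumber a * aperyNumber b := by
  rw [aperyNumber_eq_sum_range _ (show a + p * b < p * (b + 1) by rw [mul_add]; omega),
    aperyNumber_eq_sum_range _ ha, aperyNumber_eq_sum_range _ (Nat.lt_succ_self b),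
    sum_range_mul_eq_sum_sum, Finset.sum_mul_sum]
  refine Finset.sum_congr rfl fun c hc => Finset.sum_congr rfl fun d _ => ?_
  rw [choose_cast_eq_mul ha (Finset.mem_range.mp hc),
    choose_add_cast_eq_mul ha (Finset.mem_range.mp hc)]
  ring

theorem choose_cube_lucas {p : ℕ} [Fact p.Prime] {a : ℕ} (ha : a < p) (b : ℕ) :
    ((2 * (a + p * b)).choose (a + p * b) : ZMod p) ^ 3 / 64 ^ (a + p * b) =
      ((2 * a).choose a : ZMod p) ^ 3 / 64 ^ a * (((2 * b).choose b : ZMod p) ^ 3 / 64 ^ b) := by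
  rw [two_mul, choose_add_cast_eq_mul ha ha, pow_add, pow_mul, ZMod.pow_card, two_mul a, two_mul b]
  ring

theorem coeff_pow_char {p : ℕ} [Fact p.Prime] (f : PowerSeries (ZMod p)) (n : ℕ) :
    PowerSeries.coeff n (f ^ p) = if p ∣ n then PowerSeries.coeff (n / p) f else 0 := by
  have hp := (Fact.out : p.Prime).pos
  have h1 : PowerSeries.coeff n (f ^ p) =
      (PowerSeries.trunc (n + 1) (f ^ p)).coeff n := by
    rw [PowerSeries.coeff_trunc, if_pos (Nat.lt_succ_self n)]
  rw [h1, ← PowerSeries.trunc_trunc_pow, ← Polynomial.coe_pow, PowerSeries.coeff_trunc,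
    if_pos (Nat.lt_succ_self n), Polynomial.coeff_coe, ← ZMod.expand_card,
    Polynomial.coeff_expand hp]
  split_ifs
  · rw [PowerSeries.coeff_trunc, if_pos (Nat.lt_succ_of_le (Nat.div_le_self n p))]
  · rfl

theorem mk_eq_trunc_mul_pow_char {p : ℕ} [Fact p.Prime] (u : ℕ → ZMod p)
    (hu : ∀ a < p, ∀ b, u (a + p * b) = u a * u b) :
    PowerSeries.mk u = (PowerSeries.trunc p (.mk u) : PowerSeries (ZMod p)) *
      PowerSeries.mk u ^ p := by
  have hp := (Fact.out : p.Prime).pos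
  ext n
  rw [PowerSeries.coeff_mul, Finset.sum_eq_single (n % p, p * (n / p))]
  · rw [Polynomial.coeff_coe, PowerSeries.coeff_trunc, if_pos (Nat.mod_lt _ hp), coeff_pow_char,
      if_pos (dvd_mul_right _ _), Nat.mul_div_cancel_left _ hp, PowerSeries.coeff_mk,
      PowerSeries.coeff_mk, PowerSeries.coeff_mk, ← hu _ (Nat.mod_lt _ hp), Nat.mod_add_div]
  · rintro ⟨i, j⟩ hij hne
    rw [Finset.HasAntidiagonal.mem_antidiagonal] at hij
    dsimp only at hij ⊢
    rw [Polynomial.coeff_coe, PowerSeries.coeff_trunc, coeff_pow_char]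
    split_ifs with hi hj
    · exfalso
      obtain ⟨j, rfl⟩ := hj
      apply hne
      rw [← hij, Nat.add_mul_mod_self_left, Nat.mod_eq_of_lt hi, Nat.add_mul_div_left _ _ hp,
        Nat.div_eq_of_lt hi, zero_add]
    all_goals simp
  · intro h
    rw [Finset.HasAntidiagonal.mem_antidiagonal] at h
    exact absurd (Nat.mod_add_div n p) h

theorem iterate_derivative_mul_pow_char {p : ℕ} [Fact p.Prime] (P : Polynomial (ZMod p))
    (g : PowerSeries (ZMod p)) (s : ℕ) :
    (PowerSeries.derivative (ZMod p))^[s] ((P : PowerSeries (ZMod p)) * g ^ p) =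
      ((Polynomial.derivative^[s] P : Polynomial (ZMod p)) : PowerSeries (ZMod p)) * g ^ p := by
  induction s generalizing P with
  | zero => rfl
  | succ s ih =>
    rw [Function.iterate_succ_apply, Function.iterate_succ_apply, ← ih]
    congr 1
    have hp0 : (p : PowerSeries (ZMod p)) = 0 := by
      rw [← map_natCast (PowerSeries.C (R := ZMod p)), CharP.cast_eq_zero, map_zero]
    rw [Derivation.leibniz, Derivation.leibniz_pow, PowerSeries.derivative_coe]
    simp [mul_comm, hp0]

end Lucas

section ModP

open Polynomial

/-- If the truncations are nonzero after differentiation, suitable derivatives of the Apéry series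
and of `∑ C(2 n, n)³ / 64ⁿ zⁿ` satisfy no low degree relation over `𝔽_p[z]`. -/
theorem relation_mod_prime_trivial {p : ℕ} [Fact p.Prime] (hp : p % 8 = 5) {N : ℕ}
    (hN : 4 * N + 1 < p) (hp' : 30056 < p) {s k : ℕ}
    (hs : derivative^[s] (PowerSeries.trunc p (.mk fun n => (aperyNumber n : ZMod p))) ≠ 0)
    (hk : derivative^[k] (PowerSeries.trunc p
      (.mk fun n => ((2 * n).choose n : ZMod p) ^ 3 / 64 ^ n)) ≠ 0)
    (q : ℕ → ℕ → (ZMod p)[X])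
    (h : ∑ i ∈ Finset.range N, ∑ j ∈ Finset.range N, (q i j : PowerSeries (ZMod p)) *
      ((PowerSeries.derivative (ZMod p))^[s] (.mk fun n => (aperyNumber n : ZMod p)) ^ i *
      (PowerSeries.derivative (ZMod p))^[k]
        (.mk fun n => ((2 * n).choose n : ZMod p) ^ 3 / 64 ^ n) ^ j) = 0) :
    ∀ i < N, ∀ j < N, q i j = 0 := by
  set Y := PowerSeries.trunc p (.mk fun n => (aperyNumber n : ZMod p)) with hY
  set Z := PowerSeries.trunc p (.mk fun n => ((2 * n).choose n : ZMod p) ^ 3 / 64 ^ n) with hZ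
  set y := PowerSeries.mk fun n => (aperyNumber n : ZMod p) with hy
  set z := PowerSeries.mk fun n => ((2 * n).choose n : ZMod p) ^ 3 / 64 ^ n with hz
  have hyY : y = (Y : PowerSeries (ZMod p)) * y ^ p :=
    mk_eq_trunc_mul_pow_char _ fun a ha b => aperyNumber_lucas ha b
  have hzZ : z = (Z : PowerSeries (ZMod p)) * z ^ p :=
    mk_eq_trunc_mul_pow_char _ fun a ha b => choose_cube_lucas ha b
  have hYc : ∀ n < p, Y.coeff n = aperyNumber n := fun n hn => by
    rw [hY, PowerSeries.coeff_trunc, if_pos hn, PowerSeries.coeff_mk]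
  have hZc : ∀ n < p, Z.coeff n = ((2 * n).choose n : ZMod p) ^ 3 / 64 ^ n := fun n hn => by
    rw [hZ, PowerSeries.coeff_trunc, if_pos hn, PowerSeries.coeff_mk]
  have hY0 : Y.coeff 0 = 1 := by rw [hYc 0 (by omega)]; simp [aperyNumber]
  have hZ0 : Z.coeff 0 = 1 := by rw [hZc 0 (by omega)]; simp
  have hYne : Y ≠ 0 := by intro h0; simp [h0] at hY0
  have hZne : Z ≠ 0 := by intro h0; simp [h0] at hZ0
  have hyne : y ≠ 0 := by
    intro h0
    have := congrArg (PowerSeries.coeff 0) h0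
    simp [hy, aperyNumber] at this
  have hzne : z ≠ 0 := by
    intro h0
    have := congrArg (PowerSeries.coeff 0) h0
    simp [hz] at this
  have hDy : (PowerSeries.derivative (ZMod p))^[s] y * Y =
      (derivative^[s] Y : (ZMod p)[X]) * y := by
    conv_lhs => rw [hyY]
    conv_rhs => rw [hyY]
    rw [iterate_derivative_mul_pow_char]
    ring
  have hDz : (PowerSeries.derivative (ZMod p))^[k] z * Z =
      (derivative^[k] Z : (ZMod p)[X]) * z := by
    conv_lhs => rw [hzZ]
    conv_rhs => rw [hzZ]
    rw [iterate_derivative_mul_pow_char]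
    ring
  generalize (PowerSeries.derivative (ZMod p))^[s] y = ys at h hDy
  generalize (PowerSeries.derivative (ZMod p))^[k] z = zk at h hDz
  generalize derivative^[s] Y = Ys at hs hDy
  generalize derivative^[k] Z = Zk at hk hDz
  by_contra! hcon
  obtain ⟨i₀, hi₀, j₀, hj₀, hq₀⟩ := hcon
  set S := (Finset.range N ×ˢ Finset.range N).filter fun t => q t.1 t.2 ≠ 0 with hS
  set c : ℕ × ℕ → (ZMod p)[X] := fun t =>
    q t.1 t.2 * (Ys ^ t.1 * Zk ^ t.2 * Y ^ (N - t.1) * Z ^ (N - t.2)) with hc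
  have hmem : ∀ t, t ∈ S ↔ (t.1 < N ∧ t.2 < N) ∧ q t.1 t.2 ≠ 0 := by
    intro t
    rw [hS, Finset.mem_filter, Finset.mem_product, Finset.mem_range, Finset.mem_range]
  have hcharP : CharP (PowerSeries (ZMod p)) p :=
    charP_of_injective_ringHom (f := PowerSeries.C) PowerSeries.C_injective p
  obtain ⟨t, ht, t', ht', hne, u, v, hu, hv, huv⟩ := exists_pow_mul_eq_of_frobenius_relation
    (R := (ZMod p)[X]) (L := PowerSeries (ZMod p)) (m := fun t : ℕ × ℕ => y ^ t.1 * z ^ t.2)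
    (a := fun t => Y ^ t.1 * Z ^ t.2)
    (fun a b hab => by simpa [PowerSeries.algebraMap_apply'] using hab) p
    (fun t => mul_ne_zero (pow_ne_zero _ hyne) (pow_ne_zero _ hzne))
    (fun t => mul_ne_zero (pow_ne_zero _ hYne) (pow_ne_zero _ hZne))
    (fun t => by
      nth_rewrite 1 [hyY]
      nth_rewrite 1 [hzZ]
      rw [PowerSeries.algebraMap_apply']
      simp
      ring) S ⟨(i₀, j₀), (hmem _).mpr ⟨⟨hi₀, hj₀⟩, hq₀⟩⟩ c
    (fun t ht => mul_ne_zero ((hmem t).mp ht).2 (by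
      simp only [ne_eq, mul_eq_zero, not_or]
      exact ⟨⟨⟨pow_ne_zero _ hs, pow_ne_zero _ hk⟩, pow_ne_zero _ hYne⟩, pow_ne_zero _ hZne⟩))
    (by
      rw [hS, Finset.sum_filter_of_ne, Finset.sum_product]
      · have := congrArg (((Y ^ N * Z ^ N : (ZMod p)[X]) : PowerSeries (ZMod p)) * ·) h
        simp only [mul_zero, Finset.mul_sum] at this
        rw [← this]
        refine Finset.sum_congr rfl fun i hi => Finset.sum_congr rfl fun j hj => ?_
        have hi := (Finset.mem_range.mp hi).le
        have hj := (Finset.mem_range.mp hj).le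
        rw [PowerSeries.algebraMap_apply']
        simp only [hc, coe_mul, coe_pow, Algebra.algebraMap_self, PowerSeries.map_id, id_eq]
        have hYN : (Y : PowerSeries (ZMod p)) ^ N = (Y : PowerSeries (ZMod p)) ^ (N - i) *
          (Y : PowerSeries (ZMod p)) ^ i := by rw [← pow_add, Nat.sub_add_cancel hi]
        have hZN : (Z : PowerSeries (ZMod p)) ^ N = (Z : PowerSeries (ZMod p)) ^ (N - j) *
          (Z : PowerSeries (ZMod p)) ^ j := by rw [← pow_add, Nat.sub_add_cancel hj]
        have h1 := congrArg (· ^ i) hDy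
        have h2 := congrArg (· ^ j) hDz
        simp only [mul_pow] at h1 h2
        rw [hYN, hZN]
        generalize (Y : PowerSeries (ZMod p)) ^ (N - i) = A
        generalize (Z : PowerSeries (ZMod p)) ^ (N - j) = B
        linear_combination (-(q i j : PowerSeries (ZMod p)) * A * B) *
          ((Zk : PowerSeries (ZMod p)) ^ j * z ^ j * h1 +
          ys ^ i * (Y : PowerSeries (ZMod p)) ^ i * h2)
      · intro t _ h0 h1
        simp [hc, h1] at h0)
  have ht := ((hmem t).mp ht).1
  have ht' := ((hmem t').mp ht').1
  have heq := exponents_eq_of_mul_pow_eq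
    (fun g hg => not_cube_dvd_trunc_aperyNumber hp hg)
    (fun g hg => not_cube_dvd_trunc_choose_cube (by omega) hg)
    hY0 hZ0 ht'.1 ht'.2 ht.1 ht.2 hN hu hv huv
  obtain ⟨e1, e2⟩ := logarithmic_coeffs_eq hY0 hZ0 heq
  have cast_ne : ∀ m : ℕ, 0 < m → m < p → (m : ZMod p) ≠ 0 := fun m h0 h1 => by
    rw [Ne, ZMod.natCast_eq_zero_iff]
    exact Nat.not_dvd_of_pos_of_lt h0 h1
  have h2 : (2 : ZMod p) ≠ 0 := by exact_mod_cast cast_ne 2 (by omega) (by omega)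
  have h30056 : (30056 : ZMod p) ≠ 0 := by exact_mod_cast cast_ne 30056 (by omega) (by omega)
  have h64 : (64 : ZMod p) ≠ 0 := by exact_mod_cast cast_ne 64 (by omega) (by omega)
  have hY1 : Y.coeff 1 = 5 := by
    rw [hYc 1 (by omega)]; simp [aperyNumber, Finset.sum_range_succ]
  have hY2 : Y.coeff 2 = 73 := by
    rw [hYc 2 (by omega)]; simp [aperyNumber, Finset.sum_range_succ, Nat.choose]
  have hZ1 : 64 * Z.coeff 1 = 8 := by
    rw [hZc 1 (by omega)]; field_simp; norm_num [Nat.choose]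
  have hZ2 : 64 ^ 2 * Z.coeff 2 = 216 := by
    rw [hZc 2 (by omega)]; field_simp; norm_num [Nat.choose]
  rw [hY1] at e1 e2
  rw [hY2] at e2
  have e1' : 40 * (t'.1 : ZMod p) + t'.2 = 40 * t.1 + t.2 := by
    apply mul_left_cancel₀ (pow_ne_zero 3 h2)
    linear_combination 64 * e1 + ((t.2 : ZMod p) - t'.2) * hZ1
  have e2' : (30056 : ZMod p) * t'.1 = 30056 * t.1 := by
    apply mul_left_cancel₀ (pow_ne_zero 4 h2)
    linear_combination 64 ^ 2 * e2 - 16 * 23 * e1' + ((t.2 : ZMod p) - t'.2) *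
      (2 * hZ2 - (64 * Z.coeff 1 + 8) * hZ1)
  have cast_inj : ∀ m n : ℕ, m < N → n < N → (m : ZMod p) = n → m = n := fun m n hm hn hmn => by
    rw [ZMod.natCast_eq_natCast_iff'] at hmn
    rwa [Nat.mod_eq_of_lt (by omega), Nat.mod_eq_of_lt (by omega)] at hmn
  have h1 := mul_left_cancel₀ h30056 e2'
  rw [h1, add_right_inj] at e1'
  exact hne (Prod.ext (cast_inj _ _ ht.1 ht'.1 h1.symm) (cast_inj _ _ ht.2 ht'.2 e1'.symm))

end ModP

section Reduction

/-- Pairs of power series whose pairs of coefficients all lie in a given subring. -/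
def coeffPairSubring {A B : Type*} [CommRing A] [CommRing B] (S : Subring (A × B)) :
    Subring (PowerSeries A × PowerSeries B) where
  carrier := {f | ∀ n, (PowerSeries.coeff n f.1, PowerSeries.coeff n f.2) ∈ S}
  mul_mem' {f g} hf hg n := by
    have : (PowerSeries.coeff n (f * g).1, PowerSeries.coeff n (f * g).2) =
        ∑ t ∈ Finset.HasAntidiagonal.antidiagonal n,
          (PowerSeries.coeff t.1 f.1, PowerSeries.coeff t.1 f.2) *
          (PowerSeries.coeff t.2 g.1, PowerSeries.coeff t.2 g.2) := by
      ext <;> simp [PowerSeries.coeff_mul, Prod.fst_sum, Prod.snd_sum]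
    rw [this]
    exact S.sum_mem fun t _ => S.mul_mem (hf t.1) (hg t.2)
  one_mem' n := by
    simp only [Prod.fst_one, Prod.snd_one, PowerSeries.coeff_one]
    split_ifs
    exacts [S.one_mem, S.zero_mem]
  add_mem' {f g} hf hg n := by
    simpa using S.add_mem (hf n) (hg n)
  zero_mem' _ := S.zero_mem
  neg_mem' {f} hf n := by simpa using S.neg_mem (hf n)

theorem iterate_derivative_mem_coeffPairSubring {A B : Type*} [CommRing A] [CommRing B]
    {S : Subring (A × B)} {f : PowerSeries A} {g : PowerSeries B}
    (h : (f, g) ∈ coeffPairSubring S) (n : ℕ) :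
    ((PowerSeries.derivative A)^[n] f, (PowerSeries.derivative B)^[n] g) ∈
      coeffPairSubring S := by
  intro m
  rw [PowerSeries.coeff_iterate_derivative, PowerSeries.coeff_iterate_derivative]
  exact S.mul_mem (natCast_mem S ((m + 1).ascFactorial n)) (h (m + n))

/-- The graph of reduction modulo `p` on the `p`-integral rational numbers in `K`. -/
def modPrimeGraph (K : Type*) [Field K] (p : ℕ) [Fact p.Prime] : Subring (K × ZMod p) where
  carrier := {x | ∃ (d : ℕ) (a : ℤ), ¬ p ∣ d ∧ d * x.1 = a ∧ d * x.2 = a}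
  mul_mem' := by
    rintro x y ⟨d, a, hd, h1, h2⟩ ⟨d', a', hd', h1', h2'⟩
    refine ⟨d * d', a * a', fun h => ((Fact.out : p.Prime).dvd_mul.mp h).elim hd hd', ?_, ?_⟩
    · push_cast [Prod.fst_mul]
      rw [← h1, ← h1']
      ring
    · push_cast [Prod.snd_mul]
      rw [← h2, ← h2']
      ring
  one_mem' := ⟨1, 1, (Fact.out : p.Prime).one_lt.not_ge ∘ Nat.le_of_dvd one_pos, by simp, by simp⟩
  add_mem' := by
    rintro x y ⟨d, a, hd, h1, h2⟩ ⟨d', a', hd', h1', h2'⟩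
    refine ⟨d * d', d' * a + d * a', fun h => ((Fact.out : p.Prime).dvd_mul.mp h).elim hd hd',
      ?_, ?_⟩
    · push_cast [Prod.fst_add]
      rw [← h1, ← h1']
      ring
    · push_cast [Prod.snd_add]
      rw [← h2, ← h2']
      ring
  zero_mem' := ⟨1, 0, (Fact.out : p.Prime).one_lt.not_ge ∘ Nat.le_of_dvd one_pos, by simp, by simp⟩
  neg_mem' := by
    rintro x ⟨d, a, hd, h1, h2⟩
    exact ⟨d, -a, hd, by simp [h1], by simp [h2]⟩

theorem snd_eq_zero_of_mem_modPrimeGraph {K : Type*} [Field K] [CharZero K] {p : ℕ}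
    [Fact p.Prime] {y : ZMod p} (h : ((0 : K), y) ∈ modPrimeGraph K p) : y = 0 := by
  obtain ⟨d, a, hd, h1, h2⟩ := h
  rw [mul_zero] at h1
  have ha : a = 0 := by exact_mod_cast h1.symm
  rw [ha, Int.cast_zero] at h2
  refine (mul_eq_zero.mp h2).resolve_left ?_
  rwa [ZMod.natCast_eq_zero_iff]

theorem aperyNumber_pos (n : ℕ) : 0 < aperyNumber n := by
  refine Finset.sum_pos (fun j hj => ?_) ⟨0, by simp⟩
  have h1 : 0 < n.choose j := Nat.choose_pos (Nat.lt_succ_iff.mp (Finset.mem_range.mp hj))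
  have h2 : 0 < (n + j).choose j := Nat.choose_pos (by omega)
  positivity

theorem algebraicIndependent_apery_choose_cube (s k : ℕ) :
    AlgebraicIndependent (Polynomial ℤ)
      ![(PowerSeries.derivative ℂ)^[s] (PowerSeries.mk fun n => (aperyNumber n : ℂ)),
        (PowerSeries.derivative ℂ)^[k]
          (PowerSeries.mk fun n => ((2 * n).choose n : ℂ) ^ 3 / 64 ^ n)] := by
  refine algebraicIndependent_pair fun N q hq => ?_
  by_contra! hcon
  obtain ⟨i₀, hi₀, j₀, hj₀, hne⟩ := hcon
  obtain ⟨n₀, hn₀⟩ : ∃ n, (q i₀ j₀).coeff n ≠ 0 := by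
    by_contra! h
    exact hne (Polynomial.ext (by simpa using h))
  set c := (q i₀ j₀).coeff n₀
  set M := 4 * N + 30056 + s + k + c.natAbs + s.factorial * aperyNumber s +
    k.factorial * (2 * k).choose k ^ 3 + 1 with hM
  obtain ⟨p, hpM, hp, hp8⟩ := Nat.forall_exists_prime_gt_and_eq_mod (q := 8)
    (a := 5) (by decide) M
  have : Fact p.Prime := ⟨hp⟩
  have hp8' : p % 8 = 5 := by
    have : ((p : ℕ) : ZMod 8) = ((5 : ℕ) : ZMod 8) := by simpa using hp8
    exact (ZMod.natCast_eq_natCast_iff' _ _ _).mp this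
  have cast_ne : ∀ m : ℕ, 0 < m → m < p → (m : ZMod p) ≠ 0 := fun m h0 h1 => by
    rw [Ne, ZMod.natCast_eq_zero_iff]
    exact Nat.not_dvd_of_pos_of_lt h0 h1
  have h2p : ∀ n : ℕ, ¬ p ∣ 64 ^ n := fun n h =>
    absurd (Nat.le_of_dvd (by norm_num) (hp.dvd_of_dvd_pow h)) (by omega)
  have hA : ((PowerSeries.derivative ℂ)^[s] (PowerSeries.mk fun n => (aperyNumber n : ℂ)),
      (PowerSeries.derivative (ZMod p))^[s] (PowerSeries.mk fun n => (aperyNumber n : ZMod p))) ∈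
      coeffPairSubring (modPrimeGraph ℂ p) := by
    apply iterate_derivative_mem_coeffPairSubring
    intro n
    simp only [PowerSeries.coeff_mk]
    exact natCast_mem (modPrimeGraph ℂ p) (aperyNumber n)
  have hH : ((PowerSeries.derivative ℂ)^[k]
      (PowerSeries.mk fun n => ((2 * n).choose n : ℂ) ^ 3 / 64 ^ n),
      (PowerSeries.derivative (ZMod p))^[k]
        (PowerSeries.mk fun n => ((2 * n).choose n : ZMod p) ^ 3 / 64 ^ n)) ∈
      coeffPairSubring (modPrimeGraph ℂ p) := by
    apply iterate_derivative_mem_coeffPairSubring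
    intro n
    have h64 : ((64 ^ n : ℕ) : ZMod p) ≠ 0 := by
      rw [Ne, ZMod.natCast_eq_zero_iff]
      exact h2p n
    refine ⟨64 ^ n, (2 * n).choose n ^ 3, h2p n, ?_, ?_⟩
    · simp [mul_div_cancel₀]
    · push_cast at h64
      simp only [PowerSeries.coeff_mk]
      push_cast
      rw [mul_div_cancel₀ _ h64]
  have hQ : ∀ i j, (algebraMap (Polynomial ℤ) (PowerSeries ℂ) (q i j),
      (((q i j).map (Int.castRingHom (ZMod p)) : Polynomial (ZMod p)) :
        PowerSeries (ZMod p))) ∈ coeffPairSubring (modPrimeGraph ℂ p) := by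
    intro i j n
    simp only [PowerSeries.algebraMap_apply', PowerSeries.coeff_map, Polynomial.coeff_coe,
      Polynomial.coeff_map, eq_intCast]
    exact intCast_mem (modPrimeGraph ℂ p) ((q i j).coeff n)
  have hrel := (coeffPairSubring (modPrimeGraph ℂ p)).sum_mem
    (t := Finset.range N) fun i _ => (coeffPairSubring (modPrimeGraph ℂ p)).sum_mem
    (t := Finset.range N) fun j _ => (coeffPairSubring (modPrimeGraph ℂ p)).mul_mem (hQ i j)
      ((coeffPairSubring (modPrimeGraph ℂ p)).mul_mem
        ((coeffPairSubring (modPrimeGraph ℂ p)).pow_mem hA i)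
        ((coeffPairSubring (modPrimeGraph ℂ p)).pow_mem hH j))
  have hrel' := relation_mod_prime_trivial hp8' (N := N) (by omega) (by omega) (s := s) (k := k)
    ?_ ?_ (fun i j => (q i j).map (Int.castRingHom (ZMod p))) (by
      ext n
      have := hrel n
      simp only [Prod.fst_sum, Prod.snd_sum, Prod.fst_mul, Prod.snd_mul,
        Prod.pow_snd, Prod.pow_fst, hq, map_zero] at this
      exact snd_eq_zero_of_mem_modPrimeGraph this) i₀ hi₀ j₀ hj₀
  · have := congrArg (Polynomial.coeff · n₀) hrel'
    simp only [Polynomial.coeff_map, Polynomial.coeff_zero, eq_intCast] at this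
    rw [ZMod.intCast_zmod_eq_zero_iff_dvd, Int.natCast_dvd] at this
    exact absurd (Nat.le_of_dvd (Int.natAbs_pos.mpr hn₀) this) (by omega)
  · intro h
    have := congrArg (Polynomial.coeff · 0) h
    simp only [Polynomial.coeff_iterate_derivative, Polynomial.coeff_zero, zero_add,
      Nat.descFactorial_self, PowerSeries.coeff_trunc, if_pos (show s < p by omega),
      PowerSeries.coeff_mk, nsmul_eq_mul] at this
    refine cast_ne (s.factorial * aperyNumber s)
      (Nat.mul_pos s.factorial_pos (aperyNumber_pos s)) (by omega) ?_
    exact_mod_cast this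
  · intro h
    have := congrArg (Polynomial.coeff · 0) h
    simp only [Polynomial.coeff_iterate_derivative, Polynomial.coeff_zero, zero_add,
      Nat.descFactorial_self, PowerSeries.coeff_trunc, if_pos (show k < p by omega),
      PowerSeries.coeff_mk, nsmul_eq_mul] at this
    rw [← mul_div_assoc, div_eq_zero_iff] at this
    rcases this with h0 | h0
    · refine cast_ne (k.factorial * (2 * k).choose k ^ 3)
        (Nat.mul_pos k.factorial_pos (pow_pos (Nat.choose_pos (by omega)) 3)) (by omega) ?_
      exact_mod_cast h0
    · refine h2p k ((ZMod.natCast_eq_zero_iff _ _).mp ?_)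
      exact_mod_cast h0

end Reduction

section Growth

/-- The power series `f` converges absolutely at `x`, with value `v`. -/
def PowerSeriesEvalsTo (x : ℂ) (f : PowerSeries ℂ) (v : ℂ) : Prop :=
  (Summable fun n => ‖PowerSeries.coeff n f * x ^ n‖) ∧ ∑' n, PowerSeries.coeff n f * x ^ n = v

theorem PowerSeriesEvalsTo.add {x v w : ℂ} {f g : PowerSeries ℂ} (hf : PowerSeriesEvalsTo x f v)
    (hg : PowerSeriesEvalsTo x g w) : PowerSeriesEvalsTo x (f + g) (v + w) := by
  have h : ∀ n, PowerSeries.coeff n (f + g) * x ^ n =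
      PowerSeries.coeff n f * x ^ n + PowerSeries.coeff n g * x ^ n := fun n => by
    rw [map_add, add_mul]
  constructor
  · simp only [h]
    exact (hf.1.add hg.1).of_nonneg_of_le (fun _ => norm_nonneg _) fun _ => norm_add_le _ _
  · simp only [h]
    rw [hf.1.of_norm.tsum_add hg.1.of_norm, hf.2, hg.2]

theorem PowerSeriesEvalsTo.mul {x v w : ℂ} {f g : PowerSeries ℂ} (hf : PowerSeriesEvalsTo x f v)
    (hg : PowerSeriesEvalsTo x g w) : PowerSeriesEvalsTo x (f * g) (v * w) := by
  have h : ∀ n, PowerSeries.coeff n (f * g) * x ^ n =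
      ∑ t ∈ Finset.HasAntidiagonal.antidiagonal n,
        (PowerSeries.coeff t.1 f * x ^ t.1) * (PowerSeries.coeff t.2 g * x ^ t.2) := by
    intro n
    rw [PowerSeries.coeff_mul, Finset.sum_mul]
    refine Finset.sum_congr rfl fun t ht => ?_
    rw [← Finset.HasAntidiagonal.mem_antidiagonal.mp ht, pow_add]
    ring
  have key1 := summable_norm_sum_mul_antidiagonal_of_summable_norm
    (f := fun n => PowerSeries.coeff n f * x ^ n) (g := fun n => PowerSeries.coeff n g * x ^ n)
    hf.1 hg.1
  have key2 := tsum_mul_tsum_eq_tsum_sum_antidiagonal_of_summable_norm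
    (f := fun n => PowerSeries.coeff n f * x ^ n) (g := fun n => PowerSeries.coeff n g * x ^ n)
    hf.1 hg.1
  constructor
  · exact key1.congr fun n => by rw [h]
  · rw [tsum_congr h, ← hf.2, ← hg.2]
    exact key2.symm

theorem powerSeriesEvalsTo_C (x c : ℂ) : PowerSeriesEvalsTo x (PowerSeries.C c) c := by
  have h : ∀ n, PowerSeries.coeff n (PowerSeries.C c : PowerSeries ℂ) * x ^ n =
      if n = 0 then c else 0 := by
    intro n
    rw [PowerSeries.coeff_C]
    split_ifs with h <;> simp [h]
  constructor
  · simp only [h]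
    exact summable_of_ne_finset_zero (s := {0}) (by simp +contextual)
  · simp only [h, tsum_ite_eq]

/-- Pairs of a power series converging absolutely at `x` and its value there. -/
def powerSeriesEvalGraph (x : ℂ) : Subring (PowerSeries ℂ × ℂ) where
  carrier := {f | PowerSeriesEvalsTo x f.1 f.2}
  mul_mem' := PowerSeriesEvalsTo.mul
  one_mem' := by simpa using powerSeriesEvalsTo_C x 1
  add_mem' := PowerSeriesEvalsTo.add
  zero_mem' := by simpa using powerSeriesEvalsTo_C x 0
  neg_mem' {f} hf := by simpa using (powerSeriesEvalsTo_C x (-1)).mul hf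

theorem PowerSeriesEvalsTo.sum_mul_pow_mul_pow_eq_zero {x v w : ℂ} {f g : PowerSeries ℂ}
    (hf : PowerSeriesEvalsTo x f v) (hg : PowerSeriesEvalsTo x g w) {N : ℕ} {c : ℕ → ℕ → ℂ}
    (h : ∑ i ∈ Finset.range N, ∑ j ∈ Finset.range N,
      PowerSeries.C (c i j) * (f ^ i * g ^ j) = 0) :
    ∑ j ∈ Finset.range N, (∑ i ∈ Finset.range N, c i j * v ^ i) * w ^ j = 0 := by
  have hmem : ∑ i ∈ Finset.range N, ∑ j ∈ Finset.range N,
      (PowerSeries.C (c i j), c i j) * ((f, v) ^ i * (g, w) ^ j) ∈ powerSeriesEvalGraph x := by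
    refine sum_mem fun i _ => sum_mem fun j _ => ?_
    have hc : (PowerSeries.C (c i j), c i j) ∈ powerSeriesEvalGraph x :=
      powerSeriesEvalsTo_C x (c i j)
    exact mul_mem hc (mul_mem (pow_mem (show (f, v) ∈ powerSeriesEvalGraph x from hf) i)
      (pow_mem (show (g, w) ∈ powerSeriesEvalGraph x from hg) j))
  have hval := hmem.2
  simp only [Prod.fst_sum, Prod.snd_sum, Prod.fst_mul, Prod.snd_mul, Prod.pow_snd,
    Prod.pow_fst] at hval
  rw [h] at hval
  simp only [map_zero, zero_mul, tsum_zero] at hval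
  rw [Finset.sum_comm] at hval
  rw [hval]
  refine Finset.sum_congr rfl fun j _ => ?_
  rw [Finset.sum_mul]
  exact Finset.sum_congr rfl fun i _ => by ring

theorem powerSeriesEvalsTo_exp (a x : ℂ) :
    PowerSeriesEvalsTo x (PowerSeries.mk fun n => a ^ n / (n.factorial : ℂ))
      (Complex.exp (a * x)) := by
  have h : ∀ n, PowerSeries.coeff n (PowerSeries.mk fun n => a ^ n / (n.factorial : ℂ)) * x ^ n =
      (a * x) ^ n / n.factorial := by
    intro n
    rw [PowerSeries.coeff_mk, mul_pow]
    ring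
  constructor
  · simp only [h]
    exact NormedSpace.norm_expSeries_div_summable (a * x)
  · simp only [h]
    rw [Complex.exp_eq_exp_ℂ, NormedSpace.exp_eq_tsum_div]

/-- The coefficients of the Bessel type series `J₀(√-3 z)`. -/
noncomputable def besselCoeff (n : ℕ) : ℝ :=
  if n % 2 = 0 then n.choose (n / 2) * (3 / 4) ^ (n / 2) / n.factorial else 0

theorem besselCoeff_nonneg (n : ℕ) : 0 ≤ besselCoeff n := by
  unfold besselCoeff
  split_ifs <;> positivity

theorem besselCoeff_le (n : ℕ) : besselCoeff n ≤ 2 ^ n / n.factorial := by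
  unfold besselCoeff
  split_ifs
  · gcongr
    have h1 : (n.choose (n / 2) : ℝ) ≤ 2 ^ n := by exact_mod_cast Nat.choose_le_two_pow n (n / 2)
    have h2 : ((3 : ℝ) / 4) ^ (n / 2) ≤ 1 := pow_le_one₀ (by norm_num) (by norm_num)
    calc _ ≤ (2 : ℝ) ^ n * 1 := by gcongr
      _ = _ := mul_one _
  · positivity

theorem exists_powerSeriesEvalsTo_bessel (x : ℝ) : ∃ v : ℝ, 3 / 4 * x ^ 2 ≤ v ∧
    PowerSeriesEvalsTo (x : ℂ) (PowerSeries.mk fun n => (besselCoeff n : ℂ)) v := by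
  have hs : Summable fun n => ‖besselCoeff n * x ^ n‖ := by
    refine (Real.summable_pow_div_factorial (2 * |x|)).of_nonneg_of_le (fun _ => norm_nonneg _)
      fun n => ?_
    rw [norm_mul, norm_pow, Real.norm_eq_abs, Real.norm_eq_abs,
      abs_of_nonneg (besselCoeff_nonneg n),
      mul_pow, mul_div_right_comm]
    gcongr
    exact besselCoeff_le n
  refine ⟨∑' n, besselCoeff n * x ^ n, ?_, ?_, ?_⟩
  · have h2 : besselCoeff 2 * x ^ 2 = 3 / 4 * x ^ 2 := by
      simp [besselCoeff]
    rw [← h2]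
    refine hs.of_norm.le_tsum 2 fun n _ => ?_
    by_cases hn : n % 2 = 0
    · exact mul_nonneg (besselCoeff_nonneg n) ((Nat.even_iff.mpr hn).pow_nonneg x)
    · simp [besselCoeff, hn]
  · refine hs.congr fun n => ?_
    rw [PowerSeries.coeff_mk, ← Complex.ofReal_pow, ← Complex.ofReal_mul, Complex.norm_real]
  · simp only [PowerSeries.coeff_mk]
    push_cast
    rfl

/-- A polynomial relation between `exp (-a i x)` and `J₀(√-3 x)` is trivial, because the former is
periodic on the real line and the latter is unbounded along every period. -/
theorem eq_zero_of_exp_bessel_relation {a : ℝ} (ha : 0 < a) {N : ℕ} {c : ℕ → ℕ → ℂ}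
    (hc : ∑ i ∈ Finset.range N, ∑ j ∈ Finset.range N, PowerSeries.C (c i j) *
      ((PowerSeries.mk fun n => (-(a * Complex.I)) ^ n / (n.factorial : ℂ) : PowerSeries ℂ) ^ i *
        (PowerSeries.mk fun n => (besselCoeff n : ℂ)) ^ j) = 0) :
    ∀ i < N, ∀ j < N, c i j = 0 := by
  have key : ∀ x : ℝ, ∀ j < N,
      ∑ i ∈ Finset.range N, c i j * Complex.exp (-(a * Complex.I) * x) ^ i = 0 := by
    intro x
    set u := Complex.exp (-(a * Complex.I) * x) with hu
    choose v hv hmem using exists_powerSeriesEvalsTo_bessel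
    have hroot : ∀ m : ℕ, ∑ j ∈ Finset.range N, (∑ i ∈ Finset.range N, c i j * u ^ i) *
        (v (x + (2 * Real.pi / a) * m) : ℂ) ^ j = 0 := by
      intro m
      set y := x + (2 * Real.pi / a) * m with hy
      have hE := powerSeriesEvalsTo_exp (-(a * Complex.I)) y
      have huy : Complex.exp (-(a * Complex.I) * y) = u := by
        rw [hu, Complex.exp_eq_exp_iff_exists_int]
        refine ⟨-m, ?_⟩
        have : (a : ℂ) ≠ 0 := by exact_mod_cast ha.ne'
        rw [hy]
        push_cast
        field_simp
        ring
      rw [huy] at hE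
      exact (hE.sum_mul_pow_mul_pow_eq_zero (hmem y) hc)
    set P : Polynomial ℂ := ∑ j ∈ Finset.range N,
      Polynomial.monomial j (∑ i ∈ Finset.range N, c i j * u ^ i) with hP
    have hP0 : P = 0 := by
      refine Polynomial.eq_zero_of_infinite_isRoot P ?_
      have hinf : (Set.range fun m : ℕ => v (x + (2 * Real.pi / a) * m)).Infinite := by
        intro hfin
        obtain ⟨K, hK⟩ := hfin.bddAbove
        have hpi : 0 < 2 * Real.pi / a := by positivity
        obtain ⟨m, hm⟩ := exists_nat_ge ((|x| + |K| + 2) / (2 * Real.pi / a))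
        rw [div_le_iff₀ hpi] at hm
        have h1 := hv (x + (2 * Real.pi / a) * m)
        have h2 := hK ⟨m, rfl⟩
        dsimp only at h2
        have h3 := neg_abs_le x
        have h4 := le_abs_self K
        have h5 := abs_nonneg K
        have h6 : |K| + 2 ≤ x + (2 * Real.pi / a) * m := by linarith
        nlinarith
      refine (hinf.image (Complex.ofReal_injective.injOn)).mono ?_
      rintro _ ⟨_, ⟨m, rfl⟩, rfl⟩
      simp only [Set.mem_ofPred_eq, Polynomial.IsRoot.def, hP, Polynomial.eval_finsetSum,
        Polynomial.eval_monomial]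
      exact hroot m
    intro j hj
    have := congrArg (Polynomial.coeff · j) hP0
    simpa [hP, Polynomial.finsetSum_coeff, Polynomial.coeff_monomial, hj] using this
  intro i hi j hj
  set Q : Polynomial ℂ := ∑ i ∈ Finset.range N, Polynomial.monomial i (c i j) with hQ
  have hQ0 : Q = 0 := by
    refine Polynomial.eq_zero_of_infinite_isRoot Q ?_
    have hinj : Set.InjOn (fun x : ℝ => Complex.exp (-(a * Complex.I) * x))
        (Set.Ico 0 (2 * Real.pi / a)) := by
      intro x hx y hy hxy
      rw [Complex.exp_eq_exp_iff_exists_int] at hxy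
      obtain ⟨n, hn⟩ := hxy
      have him := congrArg Complex.im hn
      simp only [neg_mul, Complex.neg_im, Complex.mul_im, Complex.mul_re, Complex.add_im,
        Complex.ofReal_re, Complex.ofReal_im, Complex.I_re, Complex.I_im, Complex.intCast_re,
        Complex.intCast_im, Complex.re_ofNat, Complex.im_ofNat, mul_zero, zero_mul, mul_one,
        add_zero, zero_add, sub_zero] at him
      have hax := (lt_div_iff₀' ha).mp hx.2
      have hay := (lt_div_iff₀' ha).mp hy.2
      have hax0 := mul_nonneg ha.le hx.1
      have hay0 := mul_nonneg ha.le hy.1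
      have h1 : (n : ℝ) < 1 := by nlinarith [Real.pi_pos]
      have h2 : (-1 : ℝ) < n := by nlinarith [Real.pi_pos]
      have hn0 : n = 0 := by
        have h3 : n < 1 := by exact_mod_cast h1
        have h4 : -1 < n := by exact_mod_cast h2
        omega
      rw [hn0, Int.cast_zero, zero_mul, add_zero, neg_inj] at him
      exact mul_left_cancel₀ ha.ne' him
    have hpi : 0 < 2 * Real.pi / a := by positivity
    refine ((Set.Ico_infinite hpi).image hinj).mono ?_
    rintro _ ⟨x, _, rfl⟩
    simp only [Set.mem_ofPred_eq, Polynomial.IsRoot.def, hQ, Polynomial.eval_finsetSum,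
        Polynomial.eval_monomial]
    exact key x j hj
  have := congrArg (Polynomial.coeff · i) hQ0
  simpa [hQ, Polynomial.finsetSum_coeff, Polynomial.coeff_monomial, hi] using this

end Growth

section DividedFrobenius

/-- After multiplication of the `n`-th coefficients by `p ^ (n / p)`, the power series `f` has
coefficients reducible modulo `p`, and the coefficients of `g` reduce to the reductions at multiples
of `p`. Only the coefficients of `g` below `M` are considered. -/
def FrobeniusReduction {p : ℕ} (S : Subring (ℂ × ZMod p)) (M : ℕ) (f g : PowerSeries ℂ) : Prop :=
  ∃ y : ℕ → ZMod p, (∀ n < p * M, ((p : ℂ) ^ (n / p) * PowerSeries.coeff n f, y n) ∈ S) ∧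
    ∀ b < M, (PowerSeries.coeff b g, y (p * b)) ∈ S

variable {p : ℕ} [Fact p.Prime] {S : Subring (ℂ × ZMod p)} {M : ℕ}

theorem FrobeniusReduction.add {f f' g g' : PowerSeries ℂ} (hf : FrobeniusReduction S M f g)
    (hf' : FrobeniusReduction S M f' g') : FrobeniusReduction S M (f + f') (g + g') := by
  obtain ⟨y, h1, h2⟩ := hf
  obtain ⟨y', h1', h2'⟩ := hf'
  refine ⟨y + y', fun n hn => ?_, fun b hb => ?_⟩
  · simpa [mul_add] using S.add_mem (h1 n hn) (h1' n hn)
  · simpa using S.add_mem (h2 b hb) (h2' b hb)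

theorem sum_antidiagonal_prime_mul {y y' : ℕ → ZMod p} (b : ℕ) :
    ∑ t ∈ Finset.HasAntidiagonal.antidiagonal (p * b),
      (p : ZMod p) ^ (p * b / p - t.1 / p - t.2 / p) * (y t.1 * y' t.2) =
    ∑ t ∈ Finset.HasAntidiagonal.antidiagonal b, y (p * t.1) * y' (p * t.2) := by
  have hp := (Fact.out : p.Prime).pos
  have hinj : Set.InjOn (fun t : ℕ × ℕ => (p * t.1, p * t.2))
      (Finset.HasAntidiagonal.antidiagonal b : Finset (ℕ × ℕ)) := by
    rintro ⟨t, t'⟩ - ⟨s, s'⟩ - h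
    simpa [hp.ne'] using h
  rw [Nat.mul_div_cancel_left _ hp]
  have hsub : (Finset.HasAntidiagonal.antidiagonal b).image
      (fun t : ℕ × ℕ => (p * t.1, p * t.2)) ⊆ Finset.HasAntidiagonal.antidiagonal (p * b) := by
    intro t ht
    obtain ⟨s, hs, rfl⟩ := Finset.mem_image.mp ht
    rw [Finset.HasAntidiagonal.mem_antidiagonal] at hs ⊢
    rw [← hs, mul_add]
  rw [← Finset.sum_subset hsub, Finset.sum_image hinj]
  · refine Finset.sum_congr rfl fun t ht => ?_
    rw [Finset.HasAntidiagonal.mem_antidiagonal] at ht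
    simp only [Nat.mul_div_cancel_left _ hp]
    rw [show b - t.1 - t.2 = 0 by omega, pow_zero, one_mul]
  · intro t ht ht'
    rw [Finset.HasAntidiagonal.mem_antidiagonal] at ht
    have hpos : b - t.1 / p - t.2 / p ≠ 0 := by
      intro h0
      have h1 := Nat.div_add_mod t.1 p
      have h2 := Nat.div_add_mod t.2 p
      have h3 : b ≤ t.1 / p + t.2 / p := by omega
      have h4 : p * b ≤ p * (t.1 / p) + p * (t.2 / p) := by
        rw [← mul_add]
        exact Nat.mul_le_mul_left _ h3
      have h5 : p * (t.1 / p) + p * (t.2 / p) = p * b := by omega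
      refine ht' (Finset.mem_image.mpr ⟨(t.1 / p, t.2 / p), ?_, ?_⟩)
      · rw [Finset.HasAntidiagonal.mem_antidiagonal]
        rw [← mul_add] at h5
        exact Nat.eq_of_mul_eq_mul_left hp h5
      · ext <;> dsimp only <;> omega
    rw [CharP.cast_eq_zero, zero_pow hpos, zero_mul]

theorem FrobeniusReduction.mul {f f' g g' : PowerSeries ℂ} (hf : FrobeniusReduction S M f g)
    (hf' : FrobeniusReduction S M f' g') : FrobeniusReduction S M (f * f') (g * g') := by
  have hp := (Fact.out : p.Prime).pos
  obtain ⟨y, h1, h2⟩ := hf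
  obtain ⟨y', h1', h2'⟩ := hf'
  refine ⟨fun n => ∑ t ∈ Finset.HasAntidiagonal.antidiagonal n,
    (p : ZMod p) ^ (n / p - t.1 / p - t.2 / p) * (y t.1 * y' t.2), fun n hn => ?_, fun b hb => ?_⟩
  · have key := S.sum_mem (t := Finset.HasAntidiagonal.antidiagonal n)
      (f := fun t => (p : ℂ × ZMod p) ^ (n / p - t.1 / p - t.2 / p) *
        (((p : ℂ) ^ (t.1 / p) * PowerSeries.coeff t.1 f, y t.1) *
          ((p : ℂ) ^ (t.2 / p) * PowerSeries.coeff t.2 f', y' t.2))) fun t ht => by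
      rw [Finset.HasAntidiagonal.mem_antidiagonal] at ht
      exact S.mul_mem (S.pow_mem (natCast_mem S p) _)
        (S.mul_mem (h1 _ (by omega)) (h1' _ (by omega)))
    convert key using 1
    ext
    · simp only [Prod.fst_sum, Prod.fst_mul, Prod.pow_fst, Prod.fst_natCast]
      rw [PowerSeries.coeff_mul, Finset.mul_sum]
      refine Finset.sum_congr rfl fun t ht => ?_
      rw [Finset.HasAntidiagonal.mem_antidiagonal] at ht
      have hle : t.1 / p + t.2 / p ≤ n / p := by
        rw [← ht]
        exact Nat.div_add_div_le_add_div
      obtain ⟨e, he⟩ := Nat.exists_eq_add_of_le hle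
      rw [show n / p - t.1 / p - t.2 / p = e by omega, he, pow_add, pow_add]
      ring
    · simp only [Prod.snd_sum, Prod.snd_mul, Prod.pow_snd, Prod.snd_natCast]
  · simp only [sum_antidiagonal_prime_mul]
    have key := S.sum_mem (t := Finset.HasAntidiagonal.antidiagonal b)
      (f := fun t => (PowerSeries.coeff t.1 g, y (p * t.1)) *
        (PowerSeries.coeff t.2 g', y' (p * t.2))) fun t ht => by
      rw [Finset.HasAntidiagonal.mem_antidiagonal] at ht
      exact S.mul_mem (h2 _ (by omega)) (h2' _ (by omega))
    convert key using 1
    ext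
    · simp [Prod.fst_sum, PowerSeries.coeff_mul]
    · simp [Prod.snd_sum]

theorem frobeniusReduction_C_constantCoeff {q : PowerSeries ℂ}
    (h : ∀ n, ∃ z, (PowerSeries.coeff n q, z) ∈ S) :
    FrobeniusReduction S M q (PowerSeries.C (PowerSeries.coeff 0 q)) := by
  have hp := (Fact.out : p.Prime).pos
  choose z hz using h
  refine ⟨fun n => (p : ZMod p) ^ (n / p) * z n, fun n hn => ?_, fun b hb => ?_⟩
  · exact S.mul_mem (S.pow_mem (natCast_mem S p) (n / p)) (hz n)
  · rw [PowerSeries.coeff_C]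
    split_ifs with h
    · simpa [h] using hz 0
    · dsimp only
      rw [Nat.mul_div_cancel_left _ hp, CharP.cast_eq_zero, zero_pow h, zero_mul]
      exact S.zero_mem

variable (S M) in
/-- The pairs of power series related by `FrobeniusReduction`. -/
def frobeniusReductionSubring : Subring (PowerSeries ℂ × PowerSeries ℂ) where
  carrier := {f | FrobeniusReduction S M f.1 f.2}
  mul_mem' := FrobeniusReduction.mul
  one_mem' := by
    have := frobeniusReduction_C_constantCoeff (S := S) (M := M) (q := 1) fun n => by
      rw [PowerSeries.coeff_one]
      split_ifs
      exacts [⟨1, S.one_mem⟩, ⟨0, S.zero_mem⟩]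
    simpa using this
  add_mem' := FrobeniusReduction.add
  zero_mem' := by
    have := frobeniusReduction_C_constantCoeff (S := S) (M := M) (q := 0) fun n =>
      ⟨0, S.zero_mem⟩
    simpa using this
  neg_mem' := by
    rintro f ⟨y, h1, h2⟩
    refine ⟨-y, fun n hn => ?_, fun b hb => ?_⟩
    · simpa using S.neg_mem (h1 n hn)
    · simpa using S.neg_mem (h2 b hb)

theorem exists_factorial_eq_pow_mul {n : ℕ} (hn : n < p * p) : ∃ u : ℕ,
    n.factorial = p ^ (n / p) * u ∧ ¬ p ∣ u ∧
      (u : ZMod p) = (-1) ^ (n / p) * (n / p).factorial * (n % p).factorial := by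
  have hp := (Fact.out : p.Prime).pos
  have key : ∀ b, ∀ a < p, ∃ u : ℕ, (p * b + a).factorial = p ^ b * u ∧
      (u : ZMod p) = (-1) ^ b * b.factorial * a.factorial := by
    intro b
    induction b with
    | zero => exact fun a _ => ⟨a.factorial, by simp, by simp⟩
    | succ b ihb =>
      intro a
      induction a with
      | zero =>
        intro _
        obtain ⟨u, hu, hu'⟩ := ihb (p - 1) (by omega)
        refine ⟨(b + 1) * u, ?_, ?_⟩
        · rw [show p * (b + 1) + 0 = p * b + (p - 1) + 1 by rw [mul_add]; omega,
            Nat.factorial_succ, hu, show p * b + (p - 1) + 1 = p * (b + 1) by rw [mul_add]; omega]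
          ring
        · push_cast [hu', ZMod.wilsons_lemma, Nat.factorial_succ]
          ring
      | succ a iha =>
        intro ha
        obtain ⟨u, hu, hu'⟩ := iha (by omega)
        refine ⟨(p * (b + 1) + a + 1) * u, ?_, ?_⟩
        · rw [← add_assoc, Nat.factorial_succ, hu]
          ring
        · push_cast [hu', Nat.factorial_succ, CharP.cast_eq_zero (ZMod p) p]
          ring
  obtain ⟨u, hu, hu'⟩ := key (n / p) (n % p) (Nat.mod_lt _ hp)
  rw [Nat.div_add_mod] at hu
  refine ⟨u, hu, fun hdvd => ?_, hu'⟩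
  rw [← ZMod.natCast_eq_zero_iff, hu'] at hdvd
  have hne : ∀ m < p, (m.factorial : ZMod p) ≠ 0 := fun m hm => by
    rw [Ne, ZMod.natCast_eq_zero_iff, (Fact.out : p.Prime).dvd_factorial]
    omega
  refine mul_ne_zero (mul_ne_zero (pow_ne_zero _ (neg_ne_zero.mpr one_ne_zero))
    (hne _ (Nat.div_lt_of_lt_mul hn))) (hne _ (Nat.mod_lt _ hp)) hdvd

theorem frobeniusReduction_exp (hS : ∀ u : ℕ, ¬ p ∣ u → ((u : ℂ)⁻¹, (u : ZMod p)⁻¹) ∈ S)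
    (hM : M ≤ p) {x : ℂ} {w : ZMod p} (hx : (x, w) ∈ S) :
    FrobeniusReduction S M (PowerSeries.mk fun n => x ^ n / n.factorial)
      (PowerSeries.mk fun n => (-x) ^ n / n.factorial) := by
  have hp := (Fact.out : p.Prime).pos
  refine ⟨fun n => w ^ n / ((-1) ^ (n / p) * (n / p).factorial * (n % p).factorial),
    fun n hn => ?_, fun b hb => ?_⟩
  · obtain ⟨u, hu, hdvd, hu'⟩ :=
      exists_factorial_eq_pow_mul (hn.trans_le (Nat.mul_le_mul_left p hM))
    have hp0 : (p : ℂ) ^ (n / p) ≠ 0 := pow_ne_zero _ (Nat.cast_ne_zero.mpr hp.ne')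
    dsimp only
    rw [PowerSeries.coeff_mk, hu, ← hu', Nat.cast_mul, Nat.cast_pow]
    rw [← mul_div_assoc, mul_div_mul_left _ _ hp0, div_eq_mul_inv, div_eq_mul_inv]
    exact S.mul_mem (S.pow_mem hx n) (hS u hdvd)
  · dsimp only
    rw [PowerSeries.coeff_mk, Nat.mul_div_cancel_left _ hp, Nat.mul_mod_right, pow_mul,
      ZMod.pow_card, Nat.factorial_zero, Nat.cast_one, mul_one]
    have hb' : ¬ p ∣ b.factorial := by
      rw [(Fact.out : p.Prime).dvd_factorial]
      omega
    have := S.mul_mem (S.pow_mem (S.neg_mem hx) b) (hS _ hb')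
    convert this using 1
    ext
    · simp [div_eq_mul_inv]
    · simp only [Prod.snd_mul, Prod.pow_snd, Prod.snd_neg]
      rw [neg_pow w, div_mul_eq_div_div, div_eq_mul_inv (w ^ b), ← inv_pow, inv_neg_one]
      ring

end DividedFrobenius

section ShiftedBessel

/-- The even power series `z ^ (-e) * (d/dz) ^ (ρ - e) J₀(√-3 z)`, for `ρ` even and `e` equal to
`0` or `1`. -/
noncomputable def shiftedBessel (ρ e : ℕ) : PowerSeries ℂ :=
  PowerSeries.mk fun n => if n % 2 = 0 then
    ((n + ρ).choose ((n + ρ) / 2) : ℂ) * (3 / 4) ^ ((n + ρ) / 2) / (n + e).factorial else 0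

variable {p : ℕ} [Fact p.Prime] {S : Subring (ℂ × ZMod p)} {M : ℕ}

theorem cast_choose_half_eq_zero {ρ b : ℕ} (hρ : ρ % 2 = 0) (hρ2 : 2 ≤ ρ) (hρp : ρ < p)
    (hb : (p * b + (p - 1)) % 2 = 0) :
    ((p * b + (p - 1) + ρ).choose ((p * b + (p - 1) + ρ) / 2) : ZMod p) = 0 := by
  have hp := (Fact.out : p.Prime).pos
  set h := (p * b + (p - 1) + ρ) / 2 with hh
  have h1 : p * b + (p - 1) + ρ = (ρ - 1) + p * (b + 1) := by rw [mul_add]; omega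
  have h2 := Nat.mod_lt h hp
  have h3 := Nat.mod_add_div h p
  rw [h1, ← h3, choose_cast_eq_mul (by omega) h2, Nat.choose_eq_zero_of_lt, Nat.cast_zero, zero_mul]
  have h4 : 2 * (h % p) + p * (2 * (h / p)) = (ρ - 1) + p * (b + 1) := by
    rw [← h1, mul_left_comm, ← mul_add, h3]
    omega
  by_contra hcon
  have h5 : 2 * (h % p) < p ∨ p ≤ 2 * (h % p) := lt_or_ge _ _
  rcases h5 with h5 | h5
  · have := congrArg (· % p) h4
    simp only [Nat.add_mul_mod_self_left, Nat.mod_eq_of_lt h5,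
      Nat.mod_eq_of_lt (show ρ - 1 < p by omega)] at this
    omega
  · have h6 : 2 * (h % p) - p + p * (2 * (h / p) + 1) = (ρ - 1) + p * (b + 1) := by
      rw [← h4, mul_add]
      omega
    have := congrArg (· % p) h6
    simp only [Nat.add_mul_mod_self_left, Nat.mod_eq_of_lt (show 2 * (h % p) - p < p by omega),
      Nat.mod_eq_of_lt (show ρ - 1 < p by omega)] at this
    omega

theorem three_quarters_mem (hS : ∀ u : ℕ, ¬ p ∣ u → ((u : ℂ)⁻¹, (u : ZMod p)⁻¹) ∈ S)
    (hp2 : p ≠ 2) : ((3 / 4 : ℂ), (3 / 4 : ZMod p)) ∈ S := by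
  have hpp : p.Prime := Fact.out
  have h4 : ¬ p ∣ 4 := fun h => hp2 ((Nat.prime_dvd_prime_iff_eq hpp Nat.prime_two).mp
    (hpp.dvd_of_dvd_pow (show p ∣ 2 ^ 2 from h)))
  have := S.mul_mem (natCast_mem S 3) (hS 4 h4)
  convert this using 1
  ext <;> simp [div_eq_mul_inv]

theorem pow_mul_shiftedBessel_mem (hS : ∀ u : ℕ, ¬ p ∣ u → ((u : ℂ)⁻¹, (u : ZMod p)⁻¹) ∈ S)
    (hp2 : p ≠ 2) {ρ e n : ℕ} (hρ : ρ % 2 = 0) (he : e = 0 ∨ e = 1 ∧ 2 ≤ ρ) (hρp : ρ < p)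
    (hn : n + e < p * p) (hn2 : n % 2 = 0) :
    ∃ y, ((p : ℂ) ^ (n / p) * PowerSeries.coeff n (shiftedBessel ρ e), y) ∈ S ∧
      ∀ b, n = p * b → y = (ρ.choose (ρ / 2) : ZMod p) * (3 / 4) ^ (ρ / 2) *
        (b.choose (b / 2) * (3 / 4) ^ (b / 2) / b.factorial) := by
  have hpp : p.Prime := Fact.out
  have hp := hpp.pos
  have h34 := three_quarters_mem hS hp2
  have hchoose : ∀ c h : ℕ, ((c : ℂ) * (3 / 4) ^ h, (c : ZMod p) * (3 / 4) ^ h) ∈ S := fun c h =>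
    S.mul_mem (natCast_mem S c) (S.pow_mem h34 h)
  obtain ⟨u, hu, hdvd, hu'⟩ := exists_factorial_eq_pow_mul hn
  have hp0 : (p : ℂ) ≠ 0 := Nat.cast_ne_zero.mpr hp.ne'
  rw [shiftedBessel, PowerSeries.coeff_mk, if_pos hn2, hu, Nat.cast_mul, Nat.cast_pow]
  have hdm := Nat.div_add_mod n p
  have hmod := Nat.mod_lt n hp
  by_cases hcase : n % p + e < p
  · have hdiv : (n + e) / p = n / p := by
      rw [← hdm, add_assoc, Nat.mul_add_div hp, Nat.div_eq_of_lt hcase, Nat.mul_add_div hp,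
        Nat.div_eq_of_lt hmod]
    rw [hdiv, ← mul_div_assoc, mul_div_mul_left _ _ (pow_ne_zero _ hp0), div_eq_mul_inv]
    refine ⟨_, S.mul_mem (hchoose _ _) (hS u hdvd), ?_⟩
    rintro b rfl
    rw [hdiv, Nat.mul_div_cancel_left _ hp] at hu'
    rw [Nat.mul_mod_right, zero_add] at hcase
    have hb : b % 2 = 0 := by
      rcases hpp.eq_two_or_odd with h | h
      · exact absurd h hp2
      · rw [Nat.mul_mod, h, one_mul, Nat.mod_mod] at hn2
        exact hn2
    obtain ⟨b, rfl⟩ := Nat.dvd_of_mod_eq_zero hb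
    obtain ⟨σ, rfl⟩ := Nat.dvd_of_mod_eq_zero hρ
    have hfac : e.factorial = 1 := by rcases he with rfl | ⟨rfl, _⟩ <;> rfl
    dsimp only
    rw [hu', Nat.mul_add_mod, Nat.mod_eq_of_lt hcase, hfac,
      show p * (2 * b) + 2 * σ = 2 * σ + p * (2 * b) by ring,
      show (2 * σ + p * (2 * b)) / 2 = σ + p * b by
        rw [mul_left_comm, ← mul_add, Nat.mul_div_cancel_left _ two_pos],
      choose_cast_eq_mul hρp (by omega), pow_add (3 / 4 : ZMod p), pow_mul _ p, ZMod.pow_card,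
      Nat.mul_div_cancel_left _ two_pos, Nat.mul_div_cancel_left _ two_pos, pow_mul (-1),
      neg_one_sq,
      one_pow, Nat.cast_one, mul_one, one_mul]
    ring
  · obtain ⟨rfl, hρ2⟩ : e = 1 ∧ 2 ≤ ρ := by omega
    have ha : n % p = p - 1 := by omega
    have hn' : n = p * (n / p) + (p - 1) := by omega
    have hdiv : (n + 1) / p = n / p + 1 := by
      rw [show n + 1 = p * (n / p + 1) by rw [mul_add]; omega, Nat.mul_div_cancel_left _ hp]
    have hzero := cast_choose_half_eq_zero (p := p) hρ hρ2 hρp (hn' ▸ hn2)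
    rw [← hn', ZMod.natCast_eq_zero_iff] at hzero
    obtain ⟨c, hc⟩ := hzero
    rw [hdiv, hc, Nat.cast_mul, ← mul_div_assoc, mul_assoc (p : ℂ), ← mul_assoc, ← pow_succ,
      mul_div_mul_left _ _ (pow_ne_zero _ hp0), div_eq_mul_inv]
    refine ⟨_, S.mul_mem (hchoose _ _) (hS u hdvd), ?_⟩
    rintro b rfl
    rw [Nat.mul_mod_right] at ha
    omega

theorem frobeniusReduction_shiftedBessel
    (hS : ∀ u : ℕ, ¬ p ∣ u → ((u : ℂ)⁻¹, (u : ZMod p)⁻¹) ∈ S)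
    (hp2 : p ≠ 2) {ρ e : ℕ} (hρ : ρ % 2 = 0) (he : e = 0 ∨ e = 1 ∧ 2 ≤ ρ) (hρp : ρ < p)
    (hM : M < p) :
    FrobeniusReduction S M (shiftedBessel ρ e)
      (PowerSeries.C ((ρ.choose (ρ / 2) : ℂ) * (3 / 4) ^ (ρ / 2)) *
        PowerSeries.mk fun n => (besselCoeff n : ℂ)) := by
  have hpp : p.Prime := Fact.out
  have h34 := three_quarters_mem hS hp2
  have key : ∀ n, ∃ y, n < p * M →
      ((p : ℂ) ^ (n / p) * PowerSeries.coeff n (shiftedBessel ρ e), y) ∈ S ∧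
      ∀ b, n = p * b → (PowerSeries.coeff b
        (PowerSeries.C ((ρ.choose (ρ / 2) : ℂ) * (3 / 4) ^ (ρ / 2)) *
          PowerSeries.mk fun n => (besselCoeff n : ℂ)), y) ∈ S := by
    intro n
    by_cases hn : n < p * M
    swap
    · exact ⟨0, fun h => absurd h hn⟩
    by_cases hn2 : n % 2 = 0
    · have hlt : n + e < p * p := by
        have h1 : p * (M + 1) ≤ p * p := Nat.mul_le_mul_left p hM
        have := hpp.two_le
        rw [mul_add] at h1
        omega
      obtain ⟨y, hy, hyb⟩ := pow_mul_shiftedBessel_mem hS hp2 hρ he hρp hlt hn2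
      refine ⟨y, fun _ => ⟨hy, ?_⟩⟩
      rintro b rfl
      have hb : b % 2 = 0 := by
        rcases hpp.eq_two_or_odd with h | h
        · exact absurd h hp2
        · rw [Nat.mul_mod, h, one_mul, Nat.mod_mod] at hn2
          exact hn2
      have hbM : b < M := Nat.lt_of_mul_lt_mul_left hn
      have hb' : ¬ p ∣ b.factorial := by
        rw [hpp.dvd_factorial]
        omega
      rw [hyb b rfl, PowerSeries.coeff_C_mul, PowerSeries.coeff_mk, besselCoeff, if_pos hb]
      push_cast
      rw [div_eq_mul_inv _ (b.factorial : ℂ), div_eq_mul_inv _ (b.factorial : ZMod p)]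
      exact S.mul_mem (S.mul_mem (natCast_mem S _) (S.pow_mem h34 _))
        (S.mul_mem (S.mul_mem (natCast_mem S _) (S.pow_mem h34 _)) (hS _ hb'))
    · refine ⟨0, fun _ => ⟨?_, ?_⟩⟩
      · rw [shiftedBessel, PowerSeries.coeff_mk, if_neg hn2, mul_zero]
        exact S.zero_mem
      · rintro b rfl
        have hb : b % 2 ≠ 0 := fun hb => hn2 (by rw [Nat.mul_mod, hb, mul_zero, Nat.zero_mod])
        rw [PowerSeries.coeff_C_mul, PowerSeries.coeff_mk, besselCoeff, if_neg hb,
          Complex.ofReal_zero, mul_zero]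
        exact S.zero_mem
  choose y hy using key
  exact ⟨y, fun n hn => (hy n hn).1, fun b hb =>
    (hy (p * b) ((Nat.mul_lt_mul_left hpp.pos).mpr hb)).2 b rfl⟩

end ShiftedBessel

section SqrtNegThree

/-- The graph of reduction modulo a prime above `p`, sending `√-3` to `w`, on the elements of
`ℚ(√-3)` whose denominator is prime to `p`. -/
def sqrtNegThreeGraph {p : ℕ} [Fact p.Prime] {w : ZMod p} (hw : w ^ 2 = -3) :
    Subring (ℂ × ZMod p) where
  carrier := {x | ∃ (d : ℕ) (a b : ℤ), ¬ p ∣ d ∧ d * x.1 = a + b * (Real.sqrt 3 * Complex.I) ∧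
    d * x.2 = a + b * w}
  mul_mem' := by
    rintro x y ⟨d, a, b, hd, h1, h2⟩ ⟨d', a', b', hd', h1', h2'⟩
    refine ⟨d * d', a * a' - 3 * (b * b'), a * b' + a' * b,
      fun h => ((Fact.out : p.Prime).dvd_mul.mp h).elim hd hd', ?_, ?_⟩
    · have hs : (Real.sqrt 3 : ℂ) ^ 2 = 3 := by
        rw [← Complex.ofReal_pow, Real.sq_sqrt (by norm_num)]
        norm_num
      rw [Prod.fst_mul, Nat.cast_mul, mul_mul_mul_comm, h1, h1']
      push_cast
      linear_combination (b * b' : ℂ) * Complex.I ^ 2 * hs + 3 * (b * b' : ℂ) * Complex.I_sq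
    · rw [Prod.snd_mul, Nat.cast_mul, mul_mul_mul_comm, h2, h2']
      push_cast
      linear_combination (b * b' : ZMod p) * hw
  one_mem' := ⟨1, 1, 0, (Fact.out : p.Prime).one_lt.not_ge ∘ Nat.le_of_dvd one_pos,
    by simp, by simp⟩
  add_mem' := by
    rintro x y ⟨d, a, b, hd, h1, h2⟩ ⟨d', a', b', hd', h1', h2'⟩
    refine ⟨d * d', d' * a + d * a', d' * b + d * b',
      fun h => ((Fact.out : p.Prime).dvd_mul.mp h).elim hd hd', ?_, ?_⟩
    · push_cast [Prod.fst_add]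
      linear_combination (d' : ℂ) * h1 + (d : ℂ) * h1'
    · push_cast [Prod.snd_add]
      linear_combination (d' : ZMod p) * h2 + (d : ZMod p) * h2'
  zero_mem' := ⟨1, 0, 0, (Fact.out : p.Prime).one_lt.not_ge ∘ Nat.le_of_dvd one_pos,
    by simp, by simp⟩
  neg_mem' := by
    rintro x ⟨d, a, b, hd, h1, h2⟩
    refine ⟨d, -a, -b, hd, ?_, ?_⟩
    · push_cast [Prod.fst_neg]
      linear_combination -h1
    · push_cast [Prod.snd_neg]
      linear_combination -h2

section

variable {p : ℕ} [Fact p.Prime] {w : ZMod p} (hw : w ^ 2 = -3)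

theorem inv_natCast_mem_sqrtNegThreeGraph {u : ℕ} (hu : ¬ p ∣ u) :
    ((u : ℂ)⁻¹, (u : ZMod p)⁻¹) ∈ sqrtNegThreeGraph hw := by
  have h1 : (u : ℂ) ≠ 0 := Nat.cast_ne_zero.mpr fun h => hu (h ▸ dvd_zero p)
  have h2 : (u : ZMod p) ≠ 0 := by rwa [Ne, ZMod.natCast_eq_zero_iff]
  exact ⟨u, 1, 0, hu, by simp [h1], by simp [h2]⟩

theorem sqrt_neg_three_mem_sqrtNegThreeGraph :
    ((Real.sqrt 3 * Complex.I : ℂ), w) ∈ sqrtNegThreeGraph hw :=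
  ⟨1, 0, 1, (Fact.out : p.Prime).one_lt.not_ge ∘ Nat.le_of_dvd one_pos, by simp, by simp⟩

theorem exists_mem_sqrtNegThreeGraph_of_mem_closure (hp : p ≠ 2) {x : ℂ}
    (hx : x ∈ Subring.closure {(2 : ℂ)⁻¹}) : ∃ z, (x, z) ∈ sqrtNegThreeGraph hw := by
  have h2 : ¬ p ∣ 2 := fun h => hp ((Nat.prime_dvd_prime_iff_eq Fact.out Nat.prime_two).mp h)
  have hle : Subring.closure {(2 : ℂ)⁻¹} ≤
      (sqrtNegThreeGraph hw).map (RingHom.fst ℂ (ZMod p)) := by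
    rw [Subring.closure_le, Set.singleton_subset_iff]
    exact ⟨_, inv_natCast_mem_sqrtNegThreeGraph hw h2, rfl⟩
  obtain ⟨⟨_, z⟩, hz, rfl⟩ := hle hx
  exact ⟨z, hz⟩

end

theorem normSq_add_mul_sqrt_neg_three (a b : ℤ) :
    Complex.normSq (a + b * (Real.sqrt 3 * Complex.I)) = ((a ^ 2 + 3 * b ^ 2 : ℤ) : ℝ) := by
  have h3 : Real.sqrt 3 ^ 2 = 3 := Real.sq_sqrt (by norm_num)
  rw [Complex.normSq_apply]
  simp only [Complex.add_re, Complex.add_im, Complex.mul_re, Complex.mul_im, Complex.intCast_re,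
    Complex.intCast_im, Complex.ofReal_re, Complex.ofReal_im, Complex.I_re, Complex.I_im]
  push_cast
  linear_combination (b : ℝ) ^ 2 * h3

theorem snd_eq_zero_of_mem_sqrtNegThreeGraph {p : ℕ} [Fact p.Prime] {w y : ZMod p}
    {hw : w ^ 2 = -3} (h : ((0 : ℂ), y) ∈ sqrtNegThreeGraph hw) : y = 0 := by
  obtain ⟨d, a, b, hd, h1, h2⟩ := h
  have h3 := normSq_add_mul_sqrt_neg_three a b
  rw [← h1, mul_zero, map_zero] at h3
  have h4 : a ^ 2 + 3 * b ^ 2 = 0 := by exact_mod_cast h3.symm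
  have ha : a = 0 := by nlinarith [sq_nonneg a, sq_nonneg b]
  have hb : b = 0 := by nlinarith [sq_nonneg a, sq_nonneg b]
  rw [ha, hb, Int.cast_zero, zero_mul, add_zero] at h2
  refine (mul_eq_zero.mp h2).resolve_left ?_
  rwa [ZMod.natCast_eq_zero_iff]

theorem eq_zero_of_forall_mem_sqrtNegThreeGraph {x : ℂ}
    (h : ∀ N : ℕ, ∃ (p : ℕ) (_ : Fact p.Prime) (w : ZMod p) (hw : w ^ 2 = -3),
      N < p ∧ (x, 0) ∈ sqrtNegThreeGraph hw) : x = 0 := by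
  have norm_eq : ∀ {d : ℕ} {a b : ℤ}, d * x = a + b * (Real.sqrt 3 * Complex.I) →
      (d : ℝ) ^ 2 * Complex.normSq x = ((a ^ 2 + 3 * b ^ 2 : ℤ) : ℝ) := by
    intro d a b h1
    rw [← normSq_add_mul_sqrt_neg_three, ← h1, map_mul, Complex.normSq_natCast, sq]
  obtain ⟨p₀, _, _, _, _, d₀, a₀, b₀, hd₀, h₀, _⟩ := h 0
  obtain ⟨p, hpp, w, hw, hp, d, a, b, hd, h1, h2⟩ := h (a₀ ^ 2 + 3 * b₀ ^ 2).natAbs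
  have e0 := norm_eq h₀
  have e1 := norm_eq h1
  have hdvd : (p : ℤ) ∣ a ^ 2 + 3 * b ^ 2 := by
    rw [← ZMod.intCast_zmod_eq_zero_iff_dvd]
    rw [mul_zero] at h2
    push_cast
    linear_combination -(a - b * w) * h2 + (b : ZMod p) ^ 2 * hw
  have hmul : (d₀ : ℤ) ^ 2 * (a ^ 2 + 3 * b ^ 2) = (d : ℤ) ^ 2 * (a₀ ^ 2 + 3 * b₀ ^ 2) := by
    have : (d₀ : ℝ) ^ 2 * ((a ^ 2 + 3 * b ^ 2 : ℤ) : ℝ) =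
        (d : ℝ) ^ 2 * ((a₀ ^ 2 + 3 * b₀ ^ 2 : ℤ) : ℝ) := by
      rw [← e0, ← e1]
      ring
    exact_mod_cast this
  have hprime : Prime (p : ℤ) := Nat.prime_iff_prime_int.mp hpp.out
  have hdvd' : (p : ℤ) ∣ a₀ ^ 2 + 3 * b₀ ^ 2 := by
    refine (hprime.dvd_or_dvd (hmul ▸ hdvd.mul_left _)).resolve_left fun h3 => hd ?_
    exact_mod_cast hprime.dvd_of_dvd_pow h3
  rw [Int.eq_zero_of_dvd_of_natAbs_lt_natAbs hdvd' (by simpa using hp), Int.cast_zero] at e0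
  refine Complex.normSq_eq_zero.mp ((mul_eq_zero.mp e0).resolve_left (pow_ne_zero 2 ?_))
  exact Nat.cast_ne_zero.mpr fun h3 => hd₀ (h3 ▸ dvd_zero p₀)

theorem exists_prime_gt_sq_eq_neg_three (N : ℕ) :
    ∃ (p : ℕ) (_ : Fact p.Prime) (w : ZMod p), N < p ∧ w ^ 2 = -3 := by
  obtain ⟨p, hp, hdvd⟩ := Nat.exists_prime_and_dvd
    (show 3 * N.factorial ^ 2 + 1 ≠ 1 by have := N.factorial_ne_zero; simpa using this)
  refine ⟨p, ⟨hp⟩, 3 * N.factorial, ?_, ?_⟩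
  · by_contra! hle
    have h1 : p ∣ 3 * N.factorial ^ 2 :=
      ((hp.dvd_factorial.mpr hle).trans (dvd_pow_self _ two_ne_zero)).mul_left 3
    exact hp.one_lt.ne' (Nat.dvd_one.mp ((Nat.dvd_add_right h1).mp hdvd))
  · rw [← ZMod.natCast_eq_zero_iff] at hdvd
    push_cast at hdvd
    linear_combination 3 * hdvd

theorem coeff_zero_eq_zero_of_exp_bessel_relation {ρ e N : ℕ} (hρ : ρ % 2 = 0)
    (he : e = 0 ∨ e = 1 ∧ 2 ≤ ρ) {q : ℕ → ℕ → PowerSeries ℂ}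
    (hq : ∀ i j n, PowerSeries.coeff n (q i j) ∈ Subring.closure {(2 : ℂ)⁻¹})
    (h : ∑ i ∈ Finset.range N, ∑ j ∈ Finset.range N, q i j *
      ((PowerSeries.mk fun n => (Real.sqrt 3 * Complex.I) ^ n / (n.factorial : ℂ)) ^ i *
        shiftedBessel ρ e ^ j) = 0) :
    ∀ i < N, ∀ j < N, PowerSeries.coeff 0 (q i j) = 0 := by
  set γ : ℂ := (ρ.choose (ρ / 2) : ℂ) * (3 / 4) ^ (ρ / 2) with hγ
  have hγ0 : γ ≠ 0 := by
    exact mul_ne_zero (Nat.cast_ne_zero.mpr (Nat.choose_pos (Nat.div_le_self ρ 2)).ne')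
      (pow_ne_zero _ (by norm_num))
  have hG : ∑ i ∈ Finset.range N, ∑ j ∈ Finset.range N,
      PowerSeries.C (PowerSeries.coeff 0 (q i j)) *
      ((PowerSeries.mk fun n => (-(Real.sqrt 3 * Complex.I)) ^ n / (n.factorial : ℂ)) ^ i *
        (PowerSeries.C γ * PowerSeries.mk fun n => (besselCoeff n : ℂ)) ^ j) = 0 := by
    ext b
    rw [map_zero]
    refine eq_zero_of_forall_mem_sqrtNegThreeGraph fun m => ?_
    obtain ⟨p, _, w, hp, hw⟩ := exists_prime_gt_sq_eq_neg_three (m + b + ρ + 2)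
    refine ⟨p, inferInstance, w, hw, by omega, ?_⟩
    set R := frobeniusReductionSubring (sqrtNegThreeGraph hw) (b + 1)
    have hS := fun u (hu : ¬ p ∣ u) => inv_natCast_mem_sqrtNegThreeGraph hw hu
    have hE : (PowerSeries.mk fun n => (Real.sqrt 3 * Complex.I) ^ n / (n.factorial : ℂ),
        PowerSeries.mk fun n => (-(Real.sqrt 3 * Complex.I)) ^ n / (n.factorial : ℂ)) ∈ R :=
      frobeniusReduction_exp hS (by omega) (sqrt_neg_three_mem_sqrtNegThreeGraph hw)
    have hB : (shiftedBessel ρ e,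
        PowerSeries.C γ * PowerSeries.mk fun n => (besselCoeff n : ℂ)) ∈ R :=
      frobeniusReduction_shiftedBessel hS (by omega) hρ he (by omega) (by omega)
    have hC : ∀ i j, (q i j, PowerSeries.C (PowerSeries.coeff 0 (q i j))) ∈ R := fun i j =>
      frobeniusReduction_C_constantCoeff fun n =>
        exists_mem_sqrtNegThreeGraph_of_mem_closure hw (by omega) (hq i j n)
    have hsum := R.sum_mem (t := Finset.range N) fun i _ =>
      R.sum_mem (t := Finset.range N) fun j _ =>
        R.mul_mem (hC i j) (R.mul_mem (R.pow_mem hE i) (R.pow_mem hB j))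
    obtain ⟨y, h1, h2⟩ := hsum
    simp only [Prod.fst_sum, Prod.snd_sum, Prod.fst_mul, Prod.snd_mul, Prod.pow_snd,
      Prod.pow_fst] at h1 h2
    rw [h] at h1
    have hpb := h1 (p * b) (Nat.mul_lt_mul_of_pos_left (Nat.lt_succ_self b)
      (Fact.out : p.Prime).pos)
    rw [map_zero, mul_zero] at hpb
    rw [← snd_eq_zero_of_mem_sqrtNegThreeGraph hpb]
    exact h2 b (Nat.lt_succ_self b)
  intro i hi j hj
  refine (mul_eq_zero.mp (eq_zero_of_exp_bessel_relation (a := Real.sqrt 3) (by positivity)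
    (c := fun i j => PowerSeries.coeff 0 (q i j) * γ ^ j) ?_ i hi j hj)).resolve_right
      (pow_ne_zero j hγ0)
  rw [← hG]
  refine Finset.sum_congr rfl fun i _ => Finset.sum_congr rfl fun j _ => ?_
  rw [map_mul, map_pow, mul_pow]
  ring

end SqrtNegThree

section Assembly

theorem iterate_derivative_bessel (r : ℕ) :
    (PowerSeries.derivative ℂ)^[r] (PowerSeries.mk fun m => if m % 2 = 0 then
      (3 : ℂ) ^ (m / 2) / (4 ^ (m / 2) * ((m / 2).factorial : ℂ) ^ 2) else 0) =
    PowerSeries.X ^ (r % 2) * shiftedBessel (r + r % 2) (r % 2) := by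
  ext n
  have hfac : ∀ m : ℕ, (m.factorial : ℂ) ≠ 0 := fun m => Nat.cast_ne_zero.mpr m.factorial_ne_zero
  rw [PowerSeries.coeff_iterate_derivative, PowerSeries.coeff_mk, PowerSeries.coeff_X_pow_mul']
  by_cases hn : (n + r) % 2 = 0
  · have hle : r % 2 ≤ n := by omega
    rw [if_pos hn, if_pos hle, shiftedBessel, PowerSeries.coeff_mk, if_pos (by omega),
      show n - r % 2 + (r + r % 2) = n + r by omega, Nat.sub_add_cancel hle]
    obtain ⟨h, hh⟩ := Nat.dvd_of_mod_eq_zero hn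
    have h1 : (n.factorial * (n + 1).ascFactorial r : ℂ) = (n + r).factorial := by
      exact_mod_cast Nat.factorial_mul_ascFactorial n r
    have h2 : ((2 * h).choose h * h.factorial * h.factorial : ℂ) = (n + r).factorial := by
      have := Nat.choose_mul_factorial_mul_factorial (show h ≤ 2 * h by omega)
      rw [show 2 * h - h = h by omega] at this
      rw [hh]
      exact_mod_cast this
    rw [hh, Nat.mul_div_cancel_left _ two_pos, div_pow, eq_div_iff (hfac n), ← mul_div_assoc,
      ← mul_div_assoc, div_mul_eq_mul_div, div_eq_div_iff
        (mul_ne_zero (pow_ne_zero _ (by norm_num)) (pow_ne_zero _ (hfac h)))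
        (pow_ne_zero _ (by norm_num))]
    linear_combination (3 ^ h * 4 ^ h : ℂ) * (h1 - h2)
  · rw [if_neg hn, mul_zero]
    split_ifs with hle
    · rw [shiftedBessel, PowerSeries.coeff_mk, if_neg (by omega)]
    · rfl

theorem algebraicIndependent_exp_bessel (r : ℕ) :
    AlgebraicIndependent (PowerSeries (Subring.closure {(2 : ℂ)⁻¹}))
      ![PowerSeries.mk fun n => (Real.sqrt 3 * Complex.I) ^ n / (n.factorial : ℂ),
        (PowerSeries.derivative ℂ)^[r] (PowerSeries.mk fun m => if m % 2 = 0 then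
          (3 : ℂ) ^ (m / 2) / (4 ^ (m / 2) * ((m / 2).factorial : ℂ) ^ 2) else 0)] := by
  rw [iterate_derivative_bessel]
  refine algebraicIndependent_pair fun N q hq => ?_
  set E : PowerSeries ℂ := PowerSeries.mk fun n => (Real.sqrt 3 * Complex.I) ^ n / (n.factorial : ℂ)
  set e := r % 2 with he
  have key : ∀ (m : ℕ) (q : ℕ → ℕ → PowerSeries (Subring.closure {(2 : ℂ)⁻¹})),
      ∑ i ∈ Finset.range N, ∑ j ∈ Finset.range N, algebraMap _ (PowerSeries ℂ) (q i j) *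
        (E ^ i * shiftedBessel (r + e) e ^ j) = 0 →
      ∀ i < N, ∀ j < N, PowerSeries.coeff m (q i j) = 0 := by
    intro m
    have h0 : ∀ q : ℕ → ℕ → PowerSeries (Subring.closure {(2 : ℂ)⁻¹}),
        ∑ i ∈ Finset.range N, ∑ j ∈ Finset.range N, algebraMap _ (PowerSeries ℂ) (q i j) *
          (E ^ i * shiftedBessel (r + e) e ^ j) = 0 →
        ∀ i < N, ∀ j < N, PowerSeries.coeff 0 (q i j) = 0 := by
      intro q hq i hi j hj
      have := coeff_zero_eq_zero_of_exp_bessel_relation (by omega) (by omega)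
        (fun i j n => by
          rw [PowerSeries.algebraMap_apply'', PowerSeries.coeff_map]
          exact (PowerSeries.coeff n (q i j)).2) hq i hi j hj
      rw [PowerSeries.algebraMap_apply'', PowerSeries.coeff_map] at this
      exact Subtype.ext this
    induction m with
    | zero => exact h0
    | succ m ih =>
      intro q hq i hi j hj
      have hX : ∀ i j, ∃ q', i < N → j < N → q i j = PowerSeries.X * q' := fun i j => by
        by_cases hij : i < N ∧ j < N
        · obtain ⟨q', hq'⟩ := PowerSeries.X_dvd_iff.mpr
            ((PowerSeries.coeff_zero_eq_constantCoeff_apply _).symm.trans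
              (h0 q hq i hij.1 j hij.2))
          exact ⟨q', fun _ _ => hq'⟩
        · exact ⟨0, fun h1 h2 => absurd ⟨h1, h2⟩ hij⟩
      choose q' hq' using hX
      rw [hq' i j hi hj, PowerSeries.coeff_succ_X_mul]
      refine ih q' ?_ i hi j hj
      refine (mul_eq_zero.mp (?_ : PowerSeries.X * _ = 0)).resolve_left PowerSeries.X_ne_zero
      rw [← hq, Finset.mul_sum]
      refine Finset.sum_congr rfl fun i hi => ?_
      rw [Finset.mul_sum]
      refine Finset.sum_congr rfl fun j hj => ?_
      rw [hq' i j (Finset.mem_range.mp hi) (Finset.mem_range.mp hj), map_mul,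
        PowerSeries.algebraMap_apply'' _ PowerSeries.X, PowerSeries.map_X, mul_assoc]
  intro i hi j hj
  ext m : 1
  have := key (m + e * j) (fun i j => q i j * PowerSeries.X ^ (e * j)) (by
    rw [← hq]
    refine Finset.sum_congr rfl fun i _ => Finset.sum_congr rfl fun j _ => ?_
    rw [map_mul, map_pow, PowerSeries.algebraMap_apply'' _ PowerSeries.X, PowerSeries.map_X,
      mul_pow, pow_mul]
    ring) i hi j hj
  rwa [PowerSeries.coeff_mul_X_pow] at this

theorem mem_range_algebraMap_powerSeries {S : Subring ℂ} {f : PowerSeries ℂ}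
    (h : ∀ n, PowerSeries.coeff n f ∈ S) :
    f ∈ Set.range (algebraMap (PowerSeries S) (PowerSeries ℂ)) := by
  refine ⟨PowerSeries.mk fun n => ⟨PowerSeries.coeff n f, h n⟩, ?_⟩
  ext n
  rw [PowerSeries.algebraMap_apply'', PowerSeries.coeff_map, PowerSeries.coeff_mk]
  rfl

theorem coeff_iterate_derivative_mem {S : Subring ℂ} {f : PowerSeries ℂ}
    (h : ∀ n, PowerSeries.coeff n f ∈ S) (r n : ℕ) :
    PowerSeries.coeff n ((PowerSeries.derivative ℂ)^[r] f) ∈ S := by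
  rw [PowerSeries.coeff_iterate_derivative]
  exact S.mul_mem (natCast_mem S _) (h _)

theorem algebraicIndependent_X_apery_choose_cube (s k : ℕ) :
    AlgebraicIndependent ℤ (Sum.elim
      ![(PowerSeries.derivative ℂ)^[s] (PowerSeries.mk fun n => (aperyNumber n : ℂ)),
        (PowerSeries.derivative ℂ)^[k]
          (PowerSeries.mk fun n => ((2 * n).choose n : ℂ) ^ 3 / 64 ^ n)]
      ![(PowerSeries.X : PowerSeries ℂ)]) := by
  have hAH := algebraicIndependent_apery_choose_cube s k
  have hX : algebraMap (Polynomial ℤ) (PowerSeries ℂ) Polynomial.X = PowerSeries.X := by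
    simp [PowerSeries.algebraMap_apply']
  refine AlgebraicIndependent.sumElim_of_tower (S := Polynomial ℤ) ?_ ?_ hAH
  · rw [algebraicIndependent_unique_type_iff, transcendental_iff_injective]
    intro P Q h
    simp only [Matrix.cons_val_fin_one, ← hX, Polynomial.aeval_algebraMap_apply,
      Polynomial.aeval_X_left_apply] at h
    exact hAH.algebraMap_injective h
  · rintro _ ⟨i, rfl⟩
    exact ⟨Polynomial.X, by simpa using hX⟩

theorem algebraicIndependent_X_apery_choose_cube_exp_bessel (r s k : ℕ) :
    AlgebraicIndependent ℤ (Sum.elim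
      ![PowerSeries.mk fun n => (Real.sqrt 3 * Complex.I) ^ n / (n.factorial : ℂ),
        (PowerSeries.derivative ℂ)^[r] (PowerSeries.mk fun m => if m % 2 = 0 then
          (3 : ℂ) ^ (m / 2) / (4 ^ (m / 2) * ((m / 2).factorial : ℂ) ^ 2) else 0)]
      (Sum.elim
        ![(PowerSeries.derivative ℂ)^[s] (PowerSeries.mk fun n => (aperyNumber n : ℂ)),
          (PowerSeries.derivative ℂ)^[k]
            (PowerSeries.mk fun n => ((2 * n).choose n : ℂ) ^ 3 / 64 ^ n)]
        ![(PowerSeries.X : PowerSeries ℂ)])) := by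
  set D := Subring.closure {(2 : ℂ)⁻¹} with hD
  have := IsScalarTower.of_algebraMap_eq' (R := ℤ) (S := PowerSeries D) (A := PowerSeries ℂ)
    (RingHom.ext_int _ _)
  refine (algebraicIndependent_X_apery_choose_cube s k).sumElim_of_tower (S := PowerSeries D) ?_
    (algebraicIndependent_exp_bessel r)
  have h2 : (2 : ℂ)⁻¹ ∈ D := Subring.subset_closure rfl
  rintro _ ⟨i, rfl⟩
  refine mem_range_algebraMap_powerSeries fun n => ?_
  fin_cases i
  · refine coeff_iterate_derivative_mem (fun n => ?_) s n
    rw [PowerSeries.coeff_mk]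
    exact natCast_mem D _
  · refine coeff_iterate_derivative_mem (fun n => ?_) k n
    rw [PowerSeries.coeff_mk, show (64 : ℂ) ^ n = 2 ^ (6 * n) by rw [pow_mul]; norm_num,
      div_eq_mul_inv, ← inv_pow]
    exact D.mul_mem (D.pow_mem (natCast_mem D _) 3) (D.pow_mem h2 _)
  · change PowerSeries.coeff n PowerSeries.X ∈ D
    rw [PowerSeries.coeff_X]
    split_ifs
    exacts [D.one_mem, D.zero_mem]

end Assembly

/-- Final remark of Section 6: with `π₃ = √3·i`, the formal power series `z`, `exp(π₃z)`,
`J₀⁽ʳ⁾(π₃z)`, `𝔄⁽ˢ⁾(z)` (Apéry) and `𝔥⁽ᵏ⁾(z)` (the ₃F₂((1/2,1/2,1/2),(1,1);z) series)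
are algebraically independent over `ℚ`; equivalently `exp(π₃z)`, `J₀⁽ʳ⁾(π₃z)`,
`𝔄⁽ˢ⁾(z)`, `𝔥⁽ᵏ⁾(z)` are algebraically independent over `ℚ(z)`. -/
theorem stmt14 (r s k : ℕ) :
    AlgebraicIndependent ℚ
      ![(PowerSeries.X : PowerSeries ℂ),
        PowerSeries.mk (fun n : ℕ =>
          ((Real.sqrt 3 : ℂ) * Complex.I) ^ n / (n.factorial : ℂ)),
        (fun F => PowerSeries.derivative ℂ F)^[r]
          (PowerSeries.mk (fun m : ℕ => if m % 2 = 0 then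
            (3 : ℂ) ^ (m / 2) / (4 ^ (m / 2) * (((m / 2).factorial : ℂ)) ^ 2) else 0)),
        (fun F => PowerSeries.derivative ℂ F)^[s]
          (PowerSeries.mk (fun n : ℕ => ((∑ j ∈ Finset.range (n + 1),
            ((n.choose j : ℂ)) ^ 2 * (((n + j).choose j : ℂ)) ^ 2)))),
        (fun F => PowerSeries.derivative ℂ F)^[k]
          (PowerSeries.mk (fun n : ℕ =>
            (((2 * n).choose n : ℂ)) ^ 3 / (64 ^ n)))] := by
  have : Algebra.IsAlgebraic ℤ ℚ := IsLocalization.isAlgebraic ℚ (nonZeroDivisors ℤ)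
  have h := ((algebraicIndependent_X_apery_choose_cube_exp_bessel r s k).extendScalars ℚ).comp
    ![Sum.inr (Sum.inr 0), Sum.inl 0, Sum.inl 1, Sum.inr (Sum.inl 0), Sum.inr (Sum.inl 1)]
    (by decide)
  have hA : (PowerSeries.mk fun n : ℕ => ∑ j ∈ Finset.range (n + 1),
      (n.choose j : ℂ) ^ 2 * ((n + j).choose j : ℂ) ^ 2) =
      PowerSeries.mk fun n => (aperyNumber n : ℂ) := by
    ext n
    simp [aperyNumber]
  rw [hA]
  convert h using 1
  ext i : 1
  fin_cases i <;> rfl
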